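/- Let Q be a finite quiver without oriented cycles, n = (n_x)_{x∈Q0} a dimension vector, E_x = ℂ^{n_x}. Let K = (K_x) be a family of subsets K_x ⊆ {1,…,n_x} with |K_x| = k_x. For a family L = (L_x) with L_x ⊆ {1,…,k_x}, define the composed family K∘L by (K∘L)_x = {K_x(L_x(j)) : 1 ≤ j ≤ |L_x|}. Then K is Q-intersecting for n if and only if (1) edim_{Q,B}(K, n) ≥ 0, and (2) for every family L ≠ ([k_x])_{x∈Q0} that is Q-intersecting for the dimension vector k = (k_x), the composed family K∘L is Q-intersecting for n. -/

import Mathlib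

open Matrix

noncomputable section

/-- The standard flag subspace `span(e_1, …, e_j)` of `ℂ^n` (with 0-indexed coordinates,
this is the space of vectors vanishing on all coordinates `≥ j`). -/
def stdFlag (n j : ℕ) : Submodule ℂ (Fin n → ℂ) where
  carrier := {f | ∀ i : Fin n, j ≤ (i : ℕ) → f i = 0}
  add_mem' := by
    intro a b ha hb i hi
    simp only [Pi.add_apply, ha i hi, hb i hi, add_zero]
  zero_mem' := by intro i _; rfl
  smul_mem' := by
    intro c f hf i hi
    simp only [Pi.smul_apply, hf i hi, smul_zero]

/-- A quiver given by source and target maps has no oriented cycles. -/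
def NoCycles {V A : Type} (src tgt : A → V) : Prop :=
  ∀ (k : ℕ) (f : Fin (k + 1) → A),
    (∀ i : Fin k, tgt (f i.castSucc) = src (f i.succ)) →
    tgt (f (Fin.last k)) ≠ src (f 0)

/-- `α ≤_Q n` : every representation of the quiver on the spaces `ℂ^{n_x}` has a
subrepresentation of dimension vector `α`. -/
def HasSubrepOfDim {V A : Type} (src tgt : A → V) (n : V → ℕ) (α : V → ℕ) : Prop :=
  ∀ r : ∀ a : A, (Fin (n (src a)) → ℂ) →ₗ[ℂ] (Fin (n (tgt a)) → ℂ),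
    ∃ S : ∀ x : V, Submodule ℂ (Fin (n x) → ℂ),
      (∀ x : V, Module.finrank ℂ (S x) = α x) ∧
      (∀ a : A, (S (src a)).map (r a) ≤ S (tgt a))

/-- A family `K = (K_x)` of subsets `K_x ⊆ {1,…,n_x}` is `Q`-intersecting for `n` if every
representation of the quiver on the `ℂ^{n_x}` admits a subrepresentation `S` lying in the
Schubert variety indexed by `K` (w.r.t. the standard flags). -/
def IsQIntersecting {V A : Type} (src tgt : A → V) (n : V → ℕ)
    (K : ∀ x : V, Finset (Fin (n x))) : Prop :=
  ∀ r : ∀ a : A, (Fin (n (src a)) → ℂ) →ₗ[ℂ] (Fin (n (tgt a)) → ℂ),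
    ∃ S : ∀ x : V, Submodule ℂ (Fin (n x) → ℂ),
      (∀ x : V, Module.finrank ℂ (S x) = (K x).card) ∧
      (∀ x : V, ∀ j : Fin (K x).card,
        (j : ℕ) + 1 ≤ Module.finrank ℂ
          ((S x ⊓ stdFlag (n x) ((((K x).orderIsoOfFin rfl j : Fin (n x)) : ℕ) + 1) :
            Submodule ℂ (Fin (n x) → ℂ)))) ∧
      (∀ a : A, (S (src a)).map (r a) ≤ S (tgt a))

/-- The expected dimension `edim_{Q,B}(K, n)`. -/
def edimQB {V A : Type} [Fintype V] [Fintype A] (src tgt : A → V) (n : V → ℕ)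
    (K : ∀ x : V, Finset (Fin (n x))) : ℤ :=
  (∑ x : V, ∑ j : Fin (K x).card,
      (((((K x).orderIsoOfFin rfl j : Fin (n x)) : ℕ) : ℤ) - ((j : ℕ) : ℤ))) -
  ∑ a : A, ((K (src a)).card : ℤ) * ((n (tgt a) : ℤ) - ((K (tgt a)).card : ℤ))

/-- Composition `K ∘ L` of a family of subsets with a family of subsets of the index sets. -/
def composeFam {V : Type} {n : V → ℕ} (K : ∀ x : V, Finset (Fin (n x)))
    (L : ∀ x : V, Finset (Fin (K x).card)) : ∀ x : V, Finset (Fin (n x)) :=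
  fun x => (L x).image (fun j => ((K x).orderIsoOfFin rfl j : Fin (n x)))

/-- The moment map for the action of `∏_x U(n_x)` on the representation space of the quiver,
`μ_x(r) = Σ_{b : y→x} r_b r_b^* − Σ_{a : x→y} r_a^* r_a`. -/
def momentMap {V A : Type} [Fintype A] [DecidableEq V] (src tgt : A → V) (n : V → ℕ)
    (r : ∀ a : A, Matrix (Fin (n (tgt a))) (Fin (n (src a))) ℂ) (x : V) :
    Matrix (Fin (n x)) (Fin (n x)) ℂ :=
  (∑ a : A, if h : tgt a = x then
      Matrix.reindex (finCongr (congrArg n h)) (finCongr (congrArg n h)) (r a * (r a)ᴴ)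
    else 0) -
  (∑ a : A, if h : src a = x then
      Matrix.reindex (finCongr (congrArg n h)) (finCongr (congrArg n h)) ((r a)ᴴ * r a)
    else 0)

/-! ### The quiver `Q_{3,3}` with vertices `1,…,6` and arrows `1→3, 2→3, 4→3, 4→5, 4→6`
(0-indexed: `0→2, 1→2, 3→2, 3→4, 3→5`). -/

def q33src : Fin 5 → Fin 6 := ![0, 1, 3, 3, 3]

def q33tgt : Fin 5 → Fin 6 := ![2, 2, 2, 4, 5]

/-- The dimension vector `[p,p,p,q,q,q]` for `Q_{3,3}`. -/
def n33 (p q : ℕ) : Fin 6 → ℕ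
  | ⟨0, _⟩ => p
  | ⟨1, _⟩ => p
  | ⟨2, _⟩ => p
  | ⟨3, _⟩ => q
  | ⟨4, _⟩ => q
  | ⟨5, _⟩ => q

/-- A family of subsets for `Q_{3,3}` built from three subsets of `{1,…,p}` (vertices 1,2,3)
and three subsets of `{1,…,q}` (vertices 4,5,6). -/
def fam6 (p q : ℕ) (K : Fin 3 → Finset (Fin p)) (L : Fin 3 → Finset (Fin q)) :
    ∀ x : Fin 6, Finset (Fin (n33 p q x))
  | ⟨0, _⟩ => K 0
  | ⟨1, _⟩ => K 1
  | ⟨2, _⟩ => K 2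
  | ⟨3, _⟩ => L 0
  | ⟨4, _⟩ => L 1
  | ⟨5, _⟩ => L 2

/-! ### The pseudo-unitary group `U(p,q)` -/

/-- The matrix `η = diag(I_p, −I_q)`. -/
def etaMat (p q : ℕ) : Matrix (Fin (p + q)) (Fin (p + q)) ℂ :=
  Matrix.diagonal fun i => if (i : ℕ) < p then 1 else -1

/-- Membership in `U(p,q) = {g : gᴴ η g = η}`. -/
def InUpq (p q : ℕ) (g : Matrix (Fin (p + q)) (Fin (p + q)) ℂ) : Prop :=
  gᴴ * etaMat p q * g = etaMat p q

/-- The central element `Z = diag(q I_p, −p I_q)`. -/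
def Zmat (p q : ℕ) : Matrix (Fin (p + q)) (Fin (p + q)) ℂ :=
  Matrix.diagonal fun i => if (i : ℕ) < p then (q : ℂ) else -(p : ℂ)

/-- The complex diagonal matrix with entries a real sequence. -/
def Dmat {n : ℕ} (A : Fin n → ℝ) : Matrix (Fin n) (Fin n) ℂ :=
  Matrix.diagonal fun i => (A i : ℂ)

/-- The block-diagonal matrix `u ⊕ v`. -/
def blockDiag {p q : ℕ} (u : Matrix (Fin p) (Fin p) ℂ) (v : Matrix (Fin q) (Fin q) ℂ) :
    Matrix (Fin (p + q)) (Fin (p + q)) ℂ :=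
  Matrix.reindex finSumFinEquiv finSumFinEquiv (Matrix.fromBlocks u 0 0 v)

end

section Echelon

/-- The coordinate subspace of vectors supported on the indices satisfying `D`. -/
def coordSubspace {J : Type} (D : J → Prop) : Submodule ℂ (J → ℂ) where
  carrier := {v | ∀ j, ¬ D j → v j = 0}
  add_mem' := by
    intro v w hv hw j hj
    simp [hv j hj, hw j hj]
  zero_mem' := by intro j _; rfl
  smul_mem' := by
    intro c v hv j hj
    simp [hv j hj]

theorem finrank_coordSubspace {J : Type} [Fintype J] (D : J → Prop) [DecidablePred D] :
    Module.finrank ℂ (coordSubspace D) = (Finset.univ.filter D).card := by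
  let e : coordSubspace D ≃ₗ[ℂ] ({j // D j} → ℂ) :=
    { toFun := fun v j => v.1 j
      map_add' := fun _ _ => rfl
      map_smul' := fun _ _ => rfl
      invFun := fun c => ⟨fun j => if h : D j then c ⟨j, h⟩ else 0, fun j hj => by simp [hj]⟩
      left_inv := by
        rintro ⟨v, hv⟩
        ext j
        by_cases h : D j
        · simp [h]
        · simp [h, hv j h]
      right_inv := by
        intro c
        ext j
        simp [j.2] }
  rw [e.finrank_eq, Module.finrank_fintype_fun_eq_card, Fintype.card_subtype]

/-- A matrix in reduced column echelon form with pivot rows `L`; the entries below each pivot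
vanish. -/
structure IsEchelon {J : Type} [LinearOrder J] (L : Finset J) (ι : Matrix J L ℂ) : Prop where
  pivot : ∀ l' l : L, ι l' l = if l' = l then 1 else 0
  below : ∀ (j : J) (l : L), (l : J) < j → ι j l = 0

/-- The matrix of the coordinate projection onto the rows in `L`. -/
def rowProj {J : Type} [DecidableEq J] (L : Finset J) : Matrix L J ℂ :=
  fun l j => if (l : J) = j then 1 else 0

theorem rowProj_mul {J m : Type} [DecidableEq J] [Fintype J] (L : Finset J) (M : Matrix J m ℂ)
    (l : L) (c : m) : (rowProj L * M) l c = M l c := by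
  simp [rowProj, Matrix.mul_apply]

theorem rowProj_mulVec {J : Type} [DecidableEq J] [Fintype J] (L : Finset J) (v : J → ℂ)
    (l : L) : (rowProj L *ᵥ v) l = v l := by
  simp [rowProj, Matrix.mulVec, dotProduct]

variable {J : Type} [LinearOrder J] [Fintype J]

theorem IsEchelon.rowProj_mul_self {L : Finset J} {ι : Matrix J L ℂ} (h : IsEchelon L ι) :
    rowProj L * ι = 1 := by
  ext l' l
  rw [rowProj_mul, h.pivot, Matrix.one_apply]

theorem IsEchelon.injective {L : Finset J} {ι : Matrix J L ℂ} (h : IsEchelon L ι) :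
    Function.Injective ι.mulVecLin := by
  intro c d hcd
  simp only [Matrix.mulVecLin_apply] at hcd
  have := congrArg (fun v => rowProj L *ᵥ v) hcd
  simpa [Matrix.mulVec_mulVec, h.rowProj_mul_self] using this

theorem IsEchelon.mulVec_rowProj {L : Finset J} {ι : Matrix J L ℂ} (h : IsEchelon L ι)
    {v : J → ℂ} (hv : v ∈ LinearMap.range ι.mulVecLin) : ι *ᵥ (rowProj L *ᵥ v) = v := by
  obtain ⟨c, rfl⟩ := hv
  rw [Matrix.mulVecLin_apply, Matrix.mulVec_mulVec c (rowProj L) ι, h.rowProj_mul_self,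
    Matrix.one_mulVec]

/-- Every subspace has a basis in reduced column echelon form. -/
theorem exists_isEchelon (S : Submodule ℂ (J → ℂ)) :
    ∃ (L : Finset J) (ι : Matrix J L ℂ), IsEchelon L ι ∧ LinearMap.range ι.mulVecLin = S := by
  classical
  let L : Finset J := Finset.univ.filter fun l => ∃ v ∈ S, v l = 1 ∧ ∀ j, l < j → v j = 0
  have hL : ∀ l, l ∈ L ↔ ∃ v ∈ S, v l = 1 ∧ ∀ j, l < j → v j = 0 := by simp [L]
  have key : ∀ l, l ∈ L → ∃ v ∈ S, (∀ l' ∈ L, v l' = if l' = l then 1 else 0) ∧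
      ∀ j, l < j → v j = 0 := by
    intro l
    induction l using WellFoundedLT.induction with
    | ind l ih =>
      intro hl
      obtain ⟨v, hvS, hvl, hv⟩ := (hL l).1 hl
      choose! w hwS hw hw0 using ih
      refine ⟨v - ∑ l' ∈ L.filter (· < l), v l' • w l', ?_, ?_, ?_⟩
      · refine S.sub_mem hvS (S.sum_mem fun l' hl' => S.smul_mem _ ?_)
        rw [Finset.mem_filter] at hl'
        exact hwS l' hl'.2 hl'.1
      · intro l'' hl''
        simp only [Pi.sub_apply, Finset.sum_apply, Pi.smul_apply, smul_eq_mul]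
        have h1 : ∀ l' ∈ L.filter (· < l), v l' * w l' l'' = if l'' = l' then v l' else 0 := by
          intro l' hl'
          rw [Finset.mem_filter] at hl'
          rw [hw l' hl'.2 hl'.1 l'' hl'']
          split_ifs <;> simp
        rw [Finset.sum_congr rfl h1, Finset.sum_ite_eq]
        rcases lt_trichotomy l'' l with h | h | h
        · simp [hl'', h, h.ne]
        · subst h; simp [hvl]
        · simp [h.not_gt, h.ne', hv _ h]
      · intro j hj
        simp only [Pi.sub_apply, Finset.sum_apply, Pi.smul_apply, smul_eq_mul]
        rw [hv j hj, Finset.sum_eq_zero, sub_zero]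
        intro l' hl'
        rw [Finset.mem_filter] at hl'
        rw [hw0 l' hl'.2 hl'.1 j (hl'.2.trans hj), mul_zero]
  choose! w hwS hw hw0 using key
  have hzero : ∀ v ∈ S, (∀ l ∈ L, v l = 0) → v = 0 := by
    intro v hv hvL
    by_contra hne
    have hs : (Finset.univ.filter fun j => v j ≠ 0).Nonempty := by
      by_contra hemp
      rw [Finset.not_nonempty_iff_eq_empty, Finset.filter_eq_empty_iff] at hemp
      exact hne (funext fun j => by simpa using hemp (Finset.mem_univ j))
    have hm := Finset.max'_mem _ hs
    set m := (Finset.univ.filter fun j => v j ≠ 0).max' hs with hmdef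
    rw [Finset.mem_filter] at hm
    refine hm.2 (hvL m ((hL m).2 ⟨(v m)⁻¹ • v, S.smul_mem _ hv, ?_, ?_⟩))
    · exact inv_mul_cancel₀ hm.2
    · intro j hj
      by_contra h
      have hvj : v j ≠ 0 := fun h0 => h (by simp [h0])
      exact (Finset.le_max' (Finset.univ.filter fun j => v j ≠ 0) j (by simp [hvj])).not_gt hj
  let ι : Matrix J L ℂ := fun j l => w l j
  have hι : ∀ c : L → ℂ, ι *ᵥ c = ∑ l : L, c l • w l := by
    intro c
    ext j
    simp [ι, Matrix.mulVec, dotProduct, mul_comm]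
  have hech : IsEchelon L ι := by
    constructor
    · intro l' l
      simp only [ι]
      rw [hw l l.2 l' l'.2]
      simp only [Subtype.coe_inj]
    · intro j l hj
      exact hw0 l l.2 j hj
  refine ⟨L, ι, hech, le_antisymm ?_ ?_⟩
  · rintro _ ⟨c, rfl⟩
    rw [Matrix.mulVecLin_apply, hι]
    exact S.sum_mem fun l _ => S.smul_mem _ (hwS l l.2)
  · intro v hv
    refine ⟨rowProj L *ᵥ v, ?_⟩
    rw [Matrix.mulVecLin_apply]
    have hmem : ι *ᵥ (rowProj L *ᵥ v) ∈ S := by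
      rw [hι]
      exact S.sum_mem fun l _ => S.smul_mem _ (hwS l l.2)
    refine sub_eq_zero.1 (hzero _ (S.sub_mem hmem hv) fun l hl => ?_)
    have h1 := rowProj_mulVec L (ι *ᵥ (rowProj L *ᵥ v)) ⟨l, hl⟩
    rw [Matrix.mulVec_mulVec (rowProj L *ᵥ v), hech.rowProj_mul_self, Matrix.one_mulVec,
      rowProj_mulVec] at h1
    simp only [Pi.sub_apply]
    rw [← h1, sub_self]

theorem IsEchelon.finrank_range {L : Finset J} {ι : Matrix J L ℂ} (h : IsEchelon L ι) :
    Module.finrank ℂ (LinearMap.range ι.mulVecLin) = L.card := by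
  rw [LinearMap.finrank_range_of_inj h.injective]
  simp

/-- The dimension of the intersection with a step of the coordinate flag counts pivots. -/
theorem IsEchelon.finrank_inf {L : Finset J} {ι : Matrix J L ℂ} (h : IsEchelon L ι)
    (D : J → Prop) [DecidablePred D] (hD : ∀ i j, i ≤ j → D j → D i) :
    Module.finrank ℂ (LinearMap.range ι.mulVecLin ⊓ coordSubspace D :
      Submodule ℂ (J → ℂ)) = (L.filter D).card := by
  have h1 : LinearMap.range ι.mulVecLin ⊓ coordSubspace D =
      (coordSubspace fun l : L => D l).map ι.mulVecLin := by
    ext v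
    constructor
    · rintro ⟨hv, hvD⟩
      refine ⟨rowProj L *ᵥ v, fun l hl => ?_, h.mulVec_rowProj hv⟩
      rw [rowProj_mulVec]
      exact hvD l hl
    · rintro ⟨c, hc, rfl⟩
      refine ⟨⟨c, rfl⟩, fun j hj => ?_⟩
      rw [Matrix.mulVecLin_apply]
      refine Finset.sum_eq_zero fun l _ => ?_
      by_cases hl : D l
      · show ι j l * c l = 0
        rw [h.below j l, zero_mul]
        by_contra hlt
        exact hj (hD _ _ (not_lt.1 hlt) hl)
      · show ι j l * c l = 0
        rw [hc l hl, mul_zero]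
  rw [h1, ← (Submodule.equivMapOfInjective _ h.injective _).finrank_eq, finrank_coordSubspace]
  rw [← Finset.card_map (Function.Embedding.subtype _)]
  congr 1
  ext l
  simp [and_comm]

/-- Comparison of a strictly increasing family of positions with a set of pivots. -/
theorem exists_orderIso_le {I : Type} [LinearOrder I] (L : Finset I)
    (κ : J → I) (hcard : Fintype.card J = L.card)
    (h : ∀ j, (Finset.univ.filter (· ≤ j)).card ≤ (L.filter (· ≤ κ j)).card) :
    ∃ e : J ≃o L, ∀ j, (e j : I) ≤ κ j := by
  let e : J ≃o L := (Fintype.orderIsoFinOfCardEq J hcard).symm.trans (L.orderIsoOfFin rfl)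
  refine ⟨e, fun j => ?_⟩
  by_contra! hlt
  have h1 : (L.filter (· ≤ κ j)).card ≤ (Finset.univ.filter (· < j)).card := by
    rw [← Finset.card_map (e.toEquiv.toEmbedding.trans (Function.Embedding.subtype _))
      (s := Finset.univ.filter (· < j))]
    refine Finset.card_le_card fun l hl => ?_
    rw [Finset.mem_filter] at hl
    rw [Finset.mem_map]
    refine ⟨e.symm ⟨l, hl.1⟩, ?_, by simp⟩
    rw [Finset.mem_filter]
    refine ⟨Finset.mem_univ _, ?_⟩
    rw [OrderIso.symm_apply_lt]
    exact Subtype.coe_lt_coe.1 (lt_of_le_of_lt hl.2 hlt)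
  have h2 : (Finset.univ.filter (· < j)).card < (Finset.univ.filter (· ≤ j)).card := by
    refine Finset.card_lt_card ⟨fun i hi => ?_, fun hsub => ?_⟩
    · simp only [Finset.mem_filter, Finset.mem_univ, true_and] at hi ⊢
      exact hi.le
    · have := hsub (show j ∈ Finset.univ.filter (· ≤ j) by simp)
      simp at this
  exact absurd (h j) (not_le.2 (h1.trans_lt h2))

theorem card_le_finrank_inf {I : Type} [LinearOrder I] [Fintype I] {κ : J → I} (hκ : Monotone κ)
    {ι : Matrix I J ℂ} {p : Matrix J I ℂ} (hp : p * ι = 1)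
    (hι : ∀ i j, κ j < i → ι i j = 0) (j : J) :
    (Finset.univ.filter (· ≤ j)).card ≤ Module.finrank ℂ
      (LinearMap.range ι.mulVecLin ⊓ coordSubspace (· ≤ κ j) : Submodule ℂ (I → ℂ)) := by
  have hinj : Function.Injective ι.mulVecLin := by
    intro c d hcd
    simp only [Matrix.mulVecLin_apply] at hcd
    have := congrArg (fun v => p *ᵥ v) hcd
    simpa [Matrix.mulVec_mulVec, hp] using this
  rw [← finrank_coordSubspace, (Submodule.equivMapOfInjective _ hinj _).finrank_eq]
  refine Submodule.finrank_mono ?_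
  rintro _ ⟨c, hc, rfl⟩
  refine ⟨⟨c, rfl⟩, fun i hi => ?_⟩
  rw [Matrix.mulVecLin_apply]
  refine Finset.sum_eq_zero fun j' _ => ?_
  by_cases hj : j' ≤ j
  · show ι i j' * c j' = 0
    rw [hι i j' (lt_of_le_of_lt (hκ hj) (not_le.1 hi)), zero_mul]
  · show ι i j' * c j' = 0
    rw [hc j' hj, mul_zero]

end Echelon

section Embeds

variable {V A : Type} (src tgt : A → V)

/-- The representation `r` has a subrepresentation with a basis indexed by `J` whose `j`-th
element is supported on the indices `≤ κ j`. -/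
def Embeds {J I : V → Type} [∀ x, LinearOrder (J x)] [∀ x, Fintype (J x)]
    [∀ x, LinearOrder (I x)] [∀ x, Fintype (I x)] (κ : ∀ x, J x → I x)
    (r : ∀ a, Matrix (I (tgt a)) (I (src a)) ℂ) : Prop :=
  ∃ (u : ∀ a, Matrix (J (tgt a)) (J (src a)) ℂ) (ι : ∀ x, Matrix (I x) (J x) ℂ)
    (p : ∀ x, Matrix (J x) (I x) ℂ),
    (∀ x i j, κ x j < i → ι x i j = 0) ∧ (∀ x, p x * ι x = 1) ∧
      ∀ a, r a * ι (src a) = ι (tgt a) * u a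

/-- The family of positions `κ` is intersecting: every representation embeds `κ`. -/
def IsIntersecting {J I : V → Type} [∀ x, LinearOrder (J x)] [∀ x, Fintype (J x)]
    [∀ x, LinearOrder (I x)] [∀ x, Fintype (I x)] (κ : ∀ x, J x → I x) : Prop :=
  ∀ r : ∀ a, Matrix (I (tgt a)) (I (src a)) ℂ, Embeds src tgt κ r

variable {src tgt}
variable {J I : V → Type} [∀ x, LinearOrder (J x)] [∀ x, Fintype (J x)]
  [∀ x, LinearOrder (I x)] [∀ x, Fintype (I x)]

theorem IsIntersecting.comp {H : V → Type} [∀ x, LinearOrder (H x)] [∀ x, Fintype (H x)]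
    {κ : ∀ x, J x → I x} {μ : ∀ x, H x → J x} (hκ : IsIntersecting src tgt κ)
    (hμ : IsIntersecting src tgt μ) (hmono : ∀ x, Monotone (κ x)) :
    IsIntersecting src tgt fun x h => κ x (μ x h) := by
  intro r
  obtain ⟨u, ι, p, h1, h2, h3⟩ := hκ r
  obtain ⟨u', ι', p', h1', h2', h3'⟩ := hμ u
  refine ⟨u', fun x => ι x * ι' x, fun x => p' x * p x, ?_, ?_, ?_⟩
  · intro x i h hi
    show (ι x * ι' x) i h = 0
    rw [Matrix.mul_apply]
    refine Finset.sum_eq_zero fun j _ => ?_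
    rcases le_or_gt j (μ x h) with hj | hj
    · rw [h1 x i j ((hmono x hj).trans_lt hi), zero_mul]
    · rw [h1' x j h hj, mul_zero]
  · intro x
    rw [Matrix.mul_assoc, ← Matrix.mul_assoc (p x), h2, Matrix.one_mul, h2']
  · intro a
    rw [← Matrix.mul_assoc, h3, Matrix.mul_assoc, h3', Matrix.mul_assoc]

theorem Embeds.of_le {H : V → Type} [∀ x, LinearOrder (H x)] [∀ x, Fintype (H x)]
    {κ : ∀ x, J x → I x} {μ : ∀ x, H x → I x} {r : ∀ a, Matrix (I (tgt a)) (I (src a)) ℂ}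
    (h : Embeds src tgt μ r) (e : ∀ x, J x ≃ H x) (he : ∀ x j, μ x (e x j) ≤ κ x j) :
    Embeds src tgt κ r := by
  obtain ⟨u, ι, p, h1, h2, h3⟩ := h
  refine ⟨fun a => (u a).submatrix (e _) (e _), fun x => (ι x).submatrix id (e x),
    fun x => (p x).submatrix (e x) id, ?_, ?_, ?_⟩
  · intro x i j hj
    exact h1 x i _ ((he x j).trans_lt hj)
  · intro x
    have := Matrix.submatrix_mul (p x) (ι x) (e x) id (e x) Function.bijective_id
    rw [h2, Matrix.submatrix_one_equiv] at this
    exact this.symm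
  · intro a
    have h4 := Matrix.submatrix_mul (r a) (ι (src a)) id id (e (src a)) Function.bijective_id
    rw [Matrix.submatrix_id_id] at h4
    rw [← h4, h3, Matrix.submatrix_mul _ _ id (e (tgt a)) _ (e (tgt a)).bijective]

/-- `S` is a subrepresentation of `r`. -/
def IsSubrep (r : ∀ a, Matrix (I (tgt a)) (I (src a)) ℂ) (S : ∀ x, Submodule ℂ (I x → ℂ)) :
    Prop :=
  ∀ a, ∀ v ∈ S (src a), r a *ᵥ v ∈ S (tgt a)

theorem mul_eq_of_isSubrep {r : ∀ a, Matrix (I (tgt a)) (I (src a)) ℂ} {L : ∀ x, Finset (I x)}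
    {ι : ∀ x, Matrix (I x) (L x) ℂ} (hι : ∀ x, IsEchelon (L x) (ι x))
    (hr : IsSubrep r fun x => LinearMap.range (ι x).mulVecLin) (a : A) :
    r a * ι (src a) = ι (tgt a) * (rowProj (L (tgt a)) * r a * ι (src a)) := by
  refine Matrix.ext_of_mulVec_single fun l => ?_
  have h := (hι (tgt a)).mulVec_rowProj (hr a _ ⟨Pi.single l 1, rfl⟩)
  rw [Matrix.mulVecLin_apply] at h
  simp only [Matrix.mulVec_mulVec, Matrix.mul_assoc] at h ⊢
  exact h.symm

theorem embeds_of_isSubrep {r : ∀ a, Matrix (I (tgt a)) (I (src a)) ℂ} {L : ∀ x, Finset (I x)}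
    {ι : ∀ x, Matrix (I x) (L x) ℂ} (hι : ∀ x, IsEchelon (L x) (ι x))
    (hr : IsSubrep r fun x => LinearMap.range (ι x).mulVecLin) :
    Embeds src tgt (fun x (l : L x) => (l : I x)) r :=
  ⟨_, ι, fun x => rowProj (L x), fun x i l hl => (hι x).below i l hl,
    fun x => (hι x).rowProj_mul_self, mul_eq_of_isSubrep hι hr⟩

theorem Embeds.exists_isSubrep {κ : ∀ x, J x → I x} {r : ∀ a, Matrix (I (tgt a)) (I (src a)) ℂ}
    (hκ : ∀ x, Monotone (κ x)) (h : Embeds src tgt κ r) :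
    ∃ S : ∀ x, Submodule ℂ (I x → ℂ), IsSubrep r S ∧
      (∀ x, Module.finrank ℂ (S x) = Fintype.card (J x)) ∧
      ∀ x j, (Finset.univ.filter (· ≤ j)).card ≤
        Module.finrank ℂ (S x ⊓ coordSubspace (· ≤ κ x j) : Submodule ℂ (I x → ℂ)) := by
  obtain ⟨u, ι, p, h1, h2, h3⟩ := h
  refine ⟨fun x => LinearMap.range (ι x).mulVecLin, ?_, ?_, ?_⟩
  · rintro a _ ⟨c, rfl⟩
    refine ⟨u a *ᵥ c, ?_⟩
    simp only [Matrix.mulVecLin_apply, Matrix.mulVec_mulVec, h3]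
  · intro x
    have hinj : Function.Injective (ι x).mulVecLin := by
      intro c d hcd
      simp only [Matrix.mulVecLin_apply] at hcd
      have := congrArg (fun v => p x *ᵥ v) hcd
      simpa [Matrix.mulVec_mulVec, h2] using this
    rw [LinearMap.finrank_range_of_inj hinj, Module.finrank_fintype_fun_eq_card]
  · intro x j
    exact card_le_finrank_inf (hκ x) (h2 x) (h1 x) j

theorem IsSubrep.exists_isEchelon {r : ∀ a, Matrix (I (tgt a)) (I (src a)) ℂ}
    {S : ∀ x, Submodule ℂ (I x → ℂ)} {κ : ∀ x, J x → I x} (hS : IsSubrep r S)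
    (h1 : ∀ x, Module.finrank ℂ (S x) = Fintype.card (J x))
    (h2 : ∀ x j, (Finset.univ.filter (· ≤ j)).card ≤
        Module.finrank ℂ (S x ⊓ coordSubspace (· ≤ κ x j) : Submodule ℂ (I x → ℂ))) :
    ∃ (L : ∀ x, Finset (I x)) (ι : ∀ x, Matrix (I x) (L x) ℂ), (∀ x, IsEchelon (L x) (ι x)) ∧
      (IsSubrep r fun x => LinearMap.range (ι x).mulVecLin) ∧
      ∃ e : ∀ x, J x ≃o L x, ∀ x j, (e x j : I x) ≤ κ x j := by
  choose L ι hι hr using fun x => _root_.exists_isEchelon (S x)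
  refine ⟨L, ι, hι, by simpa only [hr] using hS, ?_⟩
  have : ∀ x, ∃ e : J x ≃o L x, ∀ j, (e j : I x) ≤ κ x j := by
    intro x
    refine exists_orderIso_le (L x) (κ x) ?_ fun j => ?_
    · rw [← h1, ← hr, (hι x).finrank_range]
    · rw [← (hι x).finrank_inf _ fun i j hij hj => hij.trans hj, hr]
      exact h2 x j
  choose e he using this
  exact ⟨e, he⟩

theorem Embeds.exists_isEchelon {κ : ∀ x, J x → I x} {r : ∀ a, Matrix (I (tgt a)) (I (src a)) ℂ}
    (hκ : ∀ x, Monotone (κ x)) (h : Embeds src tgt κ r) :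
    ∃ (L : ∀ x, Finset (I x)) (ι : ∀ x, Matrix (I x) (L x) ℂ), (∀ x, IsEchelon (L x) (ι x)) ∧
      (IsSubrep r fun x => LinearMap.range (ι x).mulVecLin) ∧
      ∃ e : ∀ x, J x ≃o L x, ∀ x j, (e x j : I x) ≤ κ x j := by
  obtain ⟨S, hS, h1, h2⟩ := h.exists_isSubrep hκ
  exact hS.exists_isEchelon h1 h2

theorem embeds_iff_exists_isSubrep {κ : ∀ x, J x → I x}
    {r : ∀ a, Matrix (I (tgt a)) (I (src a)) ℂ} (hκ : ∀ x, Monotone (κ x)) :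
    Embeds src tgt κ r ↔ ∃ S : ∀ x, Submodule ℂ (I x → ℂ), IsSubrep r S ∧
      (∀ x, Module.finrank ℂ (S x) = Fintype.card (J x)) ∧
      ∀ x j, (Finset.univ.filter (· ≤ j)).card ≤
        Module.finrank ℂ (S x ⊓ coordSubspace (· ≤ κ x j) : Submodule ℂ (I x → ℂ)) := by
  refine ⟨fun h => h.exists_isSubrep hκ, fun ⟨S, hS, h1, h2⟩ => ?_⟩
  obtain ⟨L, ι, hι, hL, e, he⟩ := hS.exists_isEchelon h1 h2
  exact (embeds_of_isSubrep hι hL).of_le (fun x => (e x).toEquiv) he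

variable [Fintype V] [Fintype A]

/-- The expected dimension of the variety of subrepresentations in position `κ`. -/
def edim (src tgt : A → V) (κ : ∀ x, J x → I x) : ℤ :=
  (∑ x, ∑ j, (((Finset.univ.filter (· < κ x j)).card : ℤ) -
      ((Finset.univ.filter (· < j)).card : ℤ))) -
    ∑ a, (Fintype.card (J (src a)) : ℤ) *
      ((Fintype.card (I (tgt a)) : ℤ) - (Fintype.card (J (tgt a)) : ℤ))

theorem edim_comp {H : V → Type} [∀ x, LinearOrder (H x)] [∀ x, Fintype (H x)]
    (κ : ∀ x, J x → I x) (μ : ∀ x, H x → J x) :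
    edim src tgt (fun x h => κ x (μ x h)) = edim src tgt μ +
      ((∑ x, ∑ h, (((Finset.univ.filter (· < κ x (μ x h))).card : ℤ) -
        ((Finset.univ.filter (· < μ x h)).card : ℤ))) -
      ∑ a, (Fintype.card (H (src a)) : ℤ) *
        ((Fintype.card (I (tgt a)) : ℤ) - (Fintype.card (J (tgt a)) : ℤ))) := by
  simp only [edim, mul_sub, Finset.sum_sub_distrib]
  ring

theorem edim_congr {H : V → Type} [∀ x, LinearOrder (H x)] [∀ x, Fintype (H x)]
    (κ : ∀ x, J x → I x) (e : ∀ x, H x ≃o J x) :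
    edim src tgt (fun x h => κ x (e x h)) = edim src tgt κ := by
  have hc : ∀ x, Fintype.card (H x) = Fintype.card (J x) :=
    fun x => Fintype.card_congr (e x).toEquiv
  simp only [edim, hc]
  congr 1
  refine Finset.sum_congr rfl fun x _ => ?_
  refine Fintype.sum_equiv (e x).toEquiv _ _ fun h => ?_
  congr 2
  refine Finset.card_equiv (e x).toEquiv fun h' => ?_
  simp

end Embeds

/-- The nonvanishing locus of a nonzero complex polynomial is dense. -/
theorem dense_eval_ne_zero {σ : Type} [Finite σ] {F : MvPolynomial σ ℂ} (hF : F ≠ 0) :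
    Dense {a : σ → ℂ | MvPolynomial.eval a F ≠ 0} := by
  obtain ⟨b, hb⟩ : ∃ b, MvPolynomial.eval b F ≠ 0 := by
    by_contra! h
    exact hF (MvPolynomial.funext fun x => by simpa using h x)
  intro a
  let q : Polynomial ℂ := MvPolynomial.aeval
    (fun i => Polynomial.C (a i) + Polynomial.X * Polynomial.C (b i - a i)) F
  have hq : ∀ t : ℂ, q.eval t = MvPolynomial.eval (fun i => a i + t * (b i - a i)) F := by
    intro t
    have h := MvPolynomial.comp_aeval_apply
      (fun i => Polynomial.C (a i) + Polynomial.X * Polynomial.C (b i - a i)) (Polynomial.aeval t) F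
    rw [Polynomial.coe_aeval_eq_eval] at h
    simp only [q]
    rw [h, MvPolynomial.aeval_eq_eval]
    simp
  have hq0 : q ≠ 0 := by
    intro h0
    apply hb
    have := hq 1
    simp [h0] at this
    exact this.symm
  have hfin : {t : ℂ | q.IsRoot t}.Finite := Polynomial.finite_setOfPred_isRoot hq0
  have hd : Dense {t : ℂ | q.IsRoot t}ᶜ := Set.Countable.dense_compl ℂ (Set.Finite.countable hfin)
  have hc : Continuous fun t : ℂ => (fun i => a i + t * (b i - a i)) := by fun_prop
  have h0 := hd 0
  have := mem_closure_image hc.continuousAt h0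
  simp only [zero_mul, add_zero] at this
  refine closure_mono ?_ this
  rintro _ ⟨t, ht, rfl⟩
  simpa [← hq] using ht

/-- The projection of a complex algebraic set is contained in a hypersurface or contains the
complement of one. -/
theorem exists_poly_of_projection {σ τ : Type} [Finite σ] [Finite τ]
    (E : Set (MvPolynomial (σ ⊕ τ) ℂ)) :
    ∃ F : MvPolynomial σ ℂ, F ≠ 0 ∧
      ((∀ a : σ → ℂ, (∃ b : τ → ℂ, ∀ p ∈ E, MvPolynomial.eval (Sum.elim a b) p = 0) →
        MvPolynomial.eval a F = 0) ∨
      (∀ a : σ → ℂ, MvPolynomial.eval a F ≠ 0 →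
        ∃ b : τ → ℂ, ∀ p ∈ E, MvPolynomial.eval (Sum.elim a b) p = 0)) := by
  classical
  let g : MvPolynomial σ ℂ →+* MvPolynomial (σ ⊕ τ) ℂ :=
    (MvPolynomial.rename (R := ℂ) (Sum.inl : σ → σ ⊕ τ)).toRingHom
  have hft : g.FiniteType := by
    have h1 : (g.comp (MvPolynomial.C : ℂ →+* MvPolynomial σ ℂ)).FiniteType := by
      have h2 : g.comp (MvPolynomial.C : ℂ →+* MvPolynomial σ ℂ) =
          algebraMap ℂ (MvPolynomial (σ ⊕ τ) ℂ) := by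
        ext
        simp [g, MvPolynomial.algebraMap_eq]
      rw [h2]
      exact RingHom.finiteType_algebraMap.mpr inferInstance
    exact RingHom.FiniteType.of_comp_finiteType h1
  have hfp : g.FinitePresentation := RingHom.FinitePresentation.of_finiteType.mp hft
  have hcons : Topology.IsConstructible (PrimeSpectrum.zeroLocus E) := by
    rw [← Topology.isConstructible_compl]
    refine IsCompact.isConstructible ?_ (PrimeSpectrum.isClosed_zeroLocus E).isOpen_compl
    exact TopologicalSpace.NoetherianSpace.isCompact _
  obtain ⟨T, hT⟩ := PrimeSpectrum.exists_constructibleSetData_iff.mpr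
    (PrimeSpectrum.isConstructible_comap_image hfp hcons)
  have hev : ∀ (a : σ → ℂ) (b : τ → ℂ) (q : MvPolynomial σ ℂ),
      MvPolynomial.eval (Sum.elim a b) (g q) = MvPolynomial.eval a q := by
    intro a b q
    simp [g, MvPolynomial.eval_rename]
  let pt : ∀ {ρ : Type}, (ρ → ℂ) → PrimeSpectrum (MvPolynomial ρ ℂ) := fun x =>
    ⟨RingHom.ker (MvPolynomial.eval x), RingHom.ker_isPrime _⟩
  by_cases hA : ∃ C ∈ T, C.f ≠ 0 ∧ ∀ i, C.g i = 0
  · obtain ⟨C, hC, hf, hg⟩ := hA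
    refine ⟨C.f, hf, Or.inr fun a ha => ?_⟩
    have hmem : pt a ∈ T.toSet := by
      simp only [PrimeSpectrum.ConstructibleSetData.toSet, Set.mem_iUnion]
      refine ⟨C, hC, ?_, ?_⟩
      · rw [PrimeSpectrum.mem_zeroLocus]
        rintro _ ⟨i, rfl⟩
        simp [hg i]
      · rw [PrimeSpectrum.mem_zeroLocus]
        intro h
        exact ha (by simpa [pt, RingHom.mem_ker] using h)
    rw [hT] at hmem
    obtain ⟨P, hP, hPa⟩ := hmem
    obtain ⟨M, hM, hPM⟩ := Ideal.exists_le_maximal P.asIdeal P.isPrime.ne_top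
    obtain ⟨x, rfl⟩ := MvPolynomial.eq_vanishingIdeal_singleton_of_isMaximal ℂ hM
    have hx : ∀ i, x (Sum.inl i) = a i := by
      intro i
      have h1 : (MvPolynomial.X i - MvPolynomial.C (a i) : MvPolynomial σ ℂ) ∈ (pt a).asIdeal := by
        simp [pt, RingHom.mem_ker]
      rw [← hPa] at h1
      have h2 := hPM h1
      simpa [g, sub_eq_zero] using h2
    refine ⟨fun j => x (Sum.inr j), fun p hp => ?_⟩
    have h1 : p ∈ P.asIdeal := hP hp
    have h2 := hPM h1
    have h3 : Sum.elim a (fun j => x (Sum.inr j)) = x := by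
      ext (i | j) <;> simp [hx]
    rw [h3]
    simpa [MvPolynomial.aeval_eq_eval] using h2
  · push Not at hA
    choose i hi using hA
    refine ⟨∏ C ∈ T.attach, if h : C.1.f ≠ 0 then C.1.g (i C.1 C.2 h) else 1, ?_, Or.inl ?_⟩
    · rw [Finset.prod_ne_zero_iff]
      intro C _
      split_ifs with h
      · exact hi C.1 C.2 h
      · exact one_ne_zero
    · rintro a ⟨b, hb⟩
      have hmem : pt a ∈ T.toSet := by
        rw [hT]
        refine ⟨pt (Sum.elim a b), fun p hp => hb p hp, ?_⟩
        ext q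
        simp [pt, RingHom.mem_ker, hev]
      simp only [PrimeSpectrum.ConstructibleSetData.toSet, Set.mem_iUnion] at hmem
      obtain ⟨C, hC, h1, h2⟩ := hmem
      have hf : C.f ≠ 0 := by
        rintro h
        apply h2
        simp [h]
      rw [map_prod]
      refine Finset.prod_eq_zero (Finset.mem_attach T ⟨C, hC⟩) ?_
      rw [dif_pos hf]
      exact h1 ⟨_, rfl⟩

section Closed

/-- Gram–Schmidt orthonormalization of the columns of a matrix, preserving supports. -/
theorem exists_orthonormal_columns {J I : Type} [LinearOrder J] [Fintype J] [LinearOrder I]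
    [Fintype I] {κ : J → I} (hκ : Monotone κ) {ι : Matrix I J ℂ} {p : Matrix J I ℂ}
    (hp : p * ι = 1) (hι : ∀ i j, κ j < i → ι i j = 0) :
    ∃ q : Matrix I J ℂ, qᴴ * q = 1 ∧ (∀ i j, κ j < i → q i j = 0) ∧
      ∃ c d : Matrix J J ℂ, q = ι * c ∧ ι = q * d := by
  classical
  let : LocallyFiniteOrder J := Fintype.toLocallyFiniteOrder
  let : LocallyFiniteOrderBot J :=
    LocallyFiniteOrderBot.ofIic' J (fun j => Finset.univ.filter (· ≤ j)) (by simp)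
  let f : J → EuclideanSpace ℂ I := fun j => WithLp.toLp 2 fun i => ι i j
  have hf : LinearIndependent ℂ f := by
    rw [Fintype.linearIndependent_iff]
    intro g hg
    have h1 : ι *ᵥ g = 0 := by
      ext i
      have := congrArg (fun v : EuclideanSpace ℂ I => v i) hg
      simpa [f, Matrix.mulVec, dotProduct, mul_comm] using this
    have h2 := congrArg (fun v => p *ᵥ v) h1
    simp only [Matrix.mulVec_mulVec, hp, Matrix.one_mulVec, Matrix.mulVec_zero] at h2
    exact fun j => congrFun h2 j
  let g := InnerProductSpace.gramSchmidtNormed ℂ f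
  have hg : Orthonormal ℂ g := InnerProductSpace.gramSchmidtNormed_orthonormal hf
  have hspan : Submodule.span ℂ (Set.range g) = Submodule.span ℂ (Set.range f) :=
    (InnerProductSpace.span_gramSchmidtNormed_range f).trans
      (InnerProductSpace.span_gramSchmidt ℂ f)
  have hc : ∀ j, ∃ c : J → ℂ, ∑ l, c l • f l = g j := fun j =>
    (Submodule.mem_span_range_iff_exists_fun ℂ).1 (hspan ▸ Submodule.subset_span ⟨j, rfl⟩)
  have hd : ∀ j, ∃ c : J → ℂ, ∑ l, c l • g l = f j := fun j =>
    (Submodule.mem_span_range_iff_exists_fun ℂ).1 (hspan ▸ Submodule.subset_span ⟨j, rfl⟩)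
  choose c hc using hc
  choose d hd using hd
  refine ⟨.of fun i j => g j i, ?_, ?_, .of fun l j => c j l, .of fun l j => d j l, ?_, ?_⟩
  · ext j l
    have := orthonormal_iff_ite.1 hg j l
    rw [Matrix.one_apply, ← this]
    simp [Matrix.mul_apply, PiLp.inner_apply, mul_comm]
  · intro i j hij
    have h1 : g j ∈ Submodule.span ℂ (f '' Set.Iic j) := by
      rw [← InnerProductSpace.span_gramSchmidt_Iic ℂ f j,
        ← InnerProductSpace.span_gramSchmidtNormed f]
      exact Submodule.subset_span ⟨j, Set.mem_Iic.2 le_rfl, rfl⟩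
    have h2 : Submodule.span ℂ (f '' Set.Iic j) ≤
        (coordSubspace (· ≤ κ j)).comap (WithLp.linearEquiv 2 ℂ (I → ℂ)).toLinearMap := by
      rw [Submodule.span_le]
      rintro _ ⟨l, hl, rfl⟩
      intro i' hi'
      exact hι i' l ((hκ hl).trans_lt (not_le.1 hi'))
    exact h2 h1 i (not_le.2 hij)
  · ext i j
    have := congrArg (fun v : EuclideanSpace ℂ I => v i) (hc j)
    simp only [Matrix.mul_apply, Matrix.of_apply, ← this]
    simp [f, mul_comm]
  · ext i j
    have := congrArg (fun v : EuclideanSpace ℂ I => v i) (hd j)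
    simp only [Matrix.mul_apply, Matrix.of_apply]
    refine this.symm.trans ?_
    simp [mul_comm]

theorem norm_apply_le_one_of_conjTranspose_mul_self {J I : Type} [DecidableEq J] [Fintype I]
    {q : Matrix I J ℂ} (hq : qᴴ * q = 1) (i : I) (j : J) : ‖q i j‖ ≤ 1 := by
  have h := congrFun (congrFun hq j) j
  rw [Matrix.mul_apply, Matrix.one_apply_eq] at h
  have h1 : ∑ i, ‖q i j‖ ^ 2 = 1 := by
    have h2 : ∀ i, qᴴ j i * q i j = ((‖q i j‖ ^ 2 : ℝ) : ℂ) := by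
      intro i
      rw [Matrix.conjTranspose_apply, Complex.star_def, Complex.conj_mul']
      push_cast
      rfl
    simp only [h2] at h
    exact_mod_cast h
  have h2 : ‖q i j‖ ^ 2 ≤ 1 := by
    rw [← h1]
    exact Finset.single_le_sum (f := fun i => ‖q i j‖ ^ 2) (fun i _ => by positivity)
      (Finset.mem_univ i)
  nlinarith [norm_nonneg (q i j)]

variable {V A : Type} {src tgt : A → V}
variable {J I : V → Type} [∀ x, LinearOrder (J x)] [∀ x, Fintype (J x)]
  [∀ x, LinearOrder (I x)] [∀ x, Fintype (I x)]

theorem isClosed_embeds {κ : ∀ x, J x → I x} (hκ : ∀ x, Monotone (κ x)) :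
    IsClosed {r : ∀ a, Matrix (I (tgt a)) (I (src a)) ℂ | Embeds src tgt κ r} := by
  let C : Set (∀ x, Matrix (I x) (J x) ℂ) :=
    {q | ∀ x, (q x)ᴴ * q x = 1 ∧ ∀ i j, κ x j < i → q x i j = 0}
  have hCc : IsClosed C := by
    simp only [C, Set.ofPred_forall, Set.ofPred_and]
    refine isClosed_iInter fun x => IsClosed.inter (isClosed_eq ?_ continuous_const)
      (isClosed_iInter fun i => isClosed_iInter fun j => isClosed_iInter fun _ =>
        isClosed_eq ?_ continuous_const)
    · fun_prop
    · exact (continuous_apply_apply i j).comp (continuous_apply x)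
  have hK : IsCompact C := by
    have hb : IsCompact (Set.pi Set.univ fun x : V =>
        (Set.pi Set.univ fun _ : I x => Set.pi Set.univ fun _ : J x =>
          Metric.closedBall (0 : ℂ) 1 : Set (Matrix (I x) (J x) ℂ))) :=
      isCompact_univ_pi fun x => isCompact_univ_pi fun i => isCompact_univ_pi fun j =>
        isCompact_closedBall _ _
    refine hb.of_isClosed_subset hCc fun q hq => ?_
    simp only [Set.mem_pi, Set.mem_univ, true_implies]
    intro x i j
    rw [mem_closedBall_zero_iff]
    exact norm_apply_le_one_of_conjTranspose_mul_self (hq x).1 i j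
  have : CompactSpace C := isCompact_iff_compactSpace.1 hK
  have hcl : IsClosed {z : C × (∀ a, Matrix (I (tgt a)) (I (src a)) ℂ) |
      ∀ a, z.2 a * z.1.1 (src a) =
        z.1.1 (tgt a) * ((z.1.1 (tgt a))ᴴ * z.2 a * z.1.1 (src a))} := by
    simp only [Set.ofPred_forall]
    refine isClosed_iInter fun a => ?_
    have h1 : ∀ x, Continuous fun z : C × (∀ a, Matrix (I (tgt a)) (I (src a)) ℂ) => z.1.1 x :=
      fun x => (continuous_apply x).comp (continuous_subtype_val.comp continuous_fst)
    have h2 : Continuous fun z : C × (∀ a, Matrix (I (tgt a)) (I (src a)) ℂ) => z.2 a :=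
      (continuous_apply a).comp continuous_snd
    exact isClosed_eq (h2.matrix_mul (h1 _))
      ((h1 _).matrix_mul (((h1 _).matrix_conjTranspose.matrix_mul h2).matrix_mul (h1 _)))
  convert isClosedMap_snd_of_compactSpace _ hcl using 1
  ext r
  constructor
  · rintro ⟨u, ι, p, h1, h2, h3⟩
    choose q hq hqs c d hc hd using fun x => exists_orthonormal_columns (hκ x) (h2 x) (h1 x)
    refine ⟨(⟨q, fun x => ⟨hq x, hqs x⟩⟩, r), fun a => ?_, rfl⟩
    have h4 : r a * q (src a) = q (tgt a) * (d (tgt a) * u a * c (src a)) := by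
      rw [hc, ← Matrix.mul_assoc, h3]
      conv_lhs => rw [hd (tgt a)]
      simp only [Matrix.mul_assoc]
    show r a * q (src a) = q (tgt a) * ((q (tgt a))ᴴ * r a * q (src a))
    rw [Matrix.mul_assoc _ (r a), h4, ← Matrix.mul_assoc (q (tgt a))ᴴ, hq, Matrix.one_mul]
  · rintro ⟨⟨⟨q, hq⟩, r⟩, h, rfl⟩
    exact ⟨_, q, fun x => (q x)ᴴ, fun x => (hq x).2, fun x => (hq x).1, h⟩

end Closed

section Dichotomy

variable {V A : Type} [Finite V] [Finite A] {src tgt : A → V}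
variable {J I : V → Type} [∀ x, LinearOrder (J x)] [∀ x, Fintype (J x)]
  [∀ x, LinearOrder (I x)] [∀ x, Fintype (I x)]

theorem exists_poly_embeds (κ : ∀ x, J x → I x) :
    ∃ F : MvPolynomial (Σ a, I (tgt a) × I (src a)) ℂ, F ≠ 0 ∧
      ((∀ r : (Σ a, I (tgt a) × I (src a)) → ℂ,
        Embeds src tgt κ (fun a => .of fun i j => r ⟨a, i, j⟩) → MvPolynomial.eval r F = 0) ∨
      (∀ r : (Σ a, I (tgt a) × I (src a)) → ℂ, MvPolynomial.eval r F ≠ 0 →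
        Embeds src tgt κ (fun a => .of fun i j => r ⟨a, i, j⟩))) := by
  let σ := Σ a, I (tgt a) × I (src a)
  let τ := (Σ a, J (tgt a) × J (src a)) ⊕ ((Σ x, I x × J x) ⊕ (Σ x, J x × I x))
  let R := MvPolynomial (σ ⊕ τ) ℂ
  let r' : ∀ a, Matrix (I (tgt a)) (I (src a)) R := fun a =>
    .of fun i j => MvPolynomial.X (Sum.inl ⟨a, i, j⟩)
  let u' : ∀ a, Matrix (J (tgt a)) (J (src a)) R := fun a =>
    .of fun i j => MvPolynomial.X (Sum.inr (Sum.inl ⟨a, i, j⟩))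
  let ι' : ∀ x, Matrix (I x) (J x) R := fun x =>
    .of fun i j => MvPolynomial.X (Sum.inr (Sum.inr (Sum.inl ⟨x, i, j⟩)))
  let p' : ∀ x, Matrix (J x) (I x) R := fun x =>
    .of fun j i => MvPolynomial.X (Sum.inr (Sum.inr (Sum.inr ⟨x, j, i⟩)))
  let E : Set R := {f | (∃ x i j, κ x j < i ∧ f = ι' x i j) ∨
    (∃ x j l, f = (p' x * ι' x - (1 : Matrix (J x) (J x) R)) j l) ∨
    ∃ a i j, f = (r' a * ι' (src a) - ι' (tgt a) * u' a) i j}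
  obtain ⟨F, hF, h⟩ := exists_poly_of_projection E
  have key : ∀ r : σ → ℂ, (∃ b : τ → ℂ, ∀ p ∈ E, MvPolynomial.eval (Sum.elim r b) p = 0) ↔
      Embeds src tgt κ (fun a => .of fun i j => r ⟨a, i, j⟩) := by
    intro r
    have aux : ∀ (b : τ → ℂ), (∀ p ∈ E, MvPolynomial.eval (Sum.elim r b) p = 0) ↔
        (∀ x i j, κ x j < i → b (Sum.inr (Sum.inl ⟨x, i, j⟩)) = 0) ∧
        (∀ x, (.of fun j i => b (Sum.inr (Sum.inr ⟨x, j, i⟩)) : Matrix (J x) (I x) ℂ) *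
          (.of fun i j => b (Sum.inr (Sum.inl ⟨x, i, j⟩)) : Matrix (I x) (J x) ℂ) = 1) ∧
        ∀ a, (.of fun i j => r ⟨a, i, j⟩ : Matrix (I (tgt a)) (I (src a)) ℂ) *
          (.of fun i j => b (Sum.inr (Sum.inl ⟨src a, i, j⟩)) : Matrix (I (src a)) (J (src a)) ℂ) =
          (.of fun i j => b (Sum.inr (Sum.inl ⟨tgt a, i, j⟩)) : Matrix (I (tgt a)) (J (tgt a)) ℂ) *
          (.of fun i j => b (Sum.inl ⟨a, i, j⟩) : Matrix (J (tgt a)) (J (src a)) ℂ) := by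
      intro b
      constructor
      · intro h
        refine ⟨fun x i j hij => ?_, fun x => ?_, fun a => ?_⟩
        · simpa [ι'] using h _ (Or.inl ⟨x, i, j, hij, rfl⟩)
        · ext j l
          have := h _ (Or.inr (Or.inl ⟨x, j, l, rfl⟩))
          simp only [p', ι', Matrix.sub_apply, Matrix.mul_apply, Matrix.of_apply, map_sub,
            map_sum, map_mul, MvPolynomial.eval_X, Sum.elim_inr, sub_eq_zero] at this
          simp only [Matrix.mul_apply, Matrix.of_apply, this, Matrix.one_apply]
          split_ifs <;> simp
        · ext i j
          have := h _ (Or.inr (Or.inr ⟨a, i, j, rfl⟩))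
          simpa only [r', u', ι', Matrix.sub_apply, Matrix.mul_apply, Matrix.of_apply, map_sub,
            map_sum, map_mul, MvPolynomial.eval_X, Sum.elim_inr, Sum.elim_inl,
            sub_eq_zero] using this
      · rintro ⟨h1, h2, h3⟩ p (⟨x, i, j, hij, rfl⟩ | ⟨x, j, l, rfl⟩ | ⟨a, i, j, rfl⟩)
        · simpa [ι'] using h1 x i j hij
        · have := congrFun (congrFun (h2 x) j) l
          simp only [Matrix.mul_apply, Matrix.of_apply, Matrix.one_apply] at this
          simp only [p', ι', Matrix.sub_apply, Matrix.mul_apply, Matrix.of_apply, map_sub,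
            map_sum, map_mul, MvPolynomial.eval_X, Sum.elim_inr, sub_eq_zero, this,
            Matrix.one_apply]
          split_ifs <;> simp
        · have := congrFun (congrFun (h3 a) i) j
          simpa only [r', u', ι', Matrix.sub_apply, Matrix.mul_apply, Matrix.of_apply, map_sub,
            map_sum, map_mul, MvPolynomial.eval_X, Sum.elim_inr, Sum.elim_inl,
            sub_eq_zero] using this
    constructor
    · rintro ⟨b, hb⟩
      obtain ⟨h1, h2, h3⟩ := (aux b).1 hb
      exact ⟨_, _, _, fun x i j hij => h1 x i j hij, h2, h3⟩
    · rintro ⟨u, ι, p, h1, h2, h3⟩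
      exact ⟨Sum.elim (fun z => u z.1 z.2.1 z.2.2) (Sum.elim (fun z => ι z.1 z.2.1 z.2.2)
        fun z => p z.1 z.2.1 z.2.2), (aux _).2 ⟨h1, h2, h3⟩⟩
  exact ⟨F, hF, h.imp (fun h r hr => h r ((key r).2 hr)) fun h r hr => (key r).1 (h r hr)⟩

/-- A family of positions is either intersecting or embeds into no generic representation. -/
theorem isIntersecting_or_dense {κ : ∀ x, J x → I x} (hκ : ∀ x, Monotone (κ x)) :
    IsIntersecting src tgt κ ∨
      Dense (interior {r : ∀ a, Matrix (I (tgt a)) (I (src a)) ℂ | ¬ Embeds src tgt κ r}) := by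
  let Φ : ((Σ a, I (tgt a) × I (src a)) → ℂ) → ∀ a, Matrix (I (tgt a)) (I (src a)) ℂ :=
    fun r a => .of fun i j => r ⟨a, i, j⟩
  let Ψ : (∀ a, Matrix (I (tgt a)) (I (src a)) ℂ) → (Σ a, I (tgt a) × I (src a)) → ℂ :=
    fun r z => r z.1 z.2.1 z.2.2
  have hΦ : Continuous Φ := continuous_pi fun a => continuous_matrix fun i j => continuous_apply _
  have hΨ : Continuous Ψ := continuous_pi fun z => (continuous_apply z.1).matrix_elem _ _
  have hΦΨ : ∀ r, Φ (Ψ r) = r := fun r => rfl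
  obtain ⟨F, hF, h⟩ := exists_poly_embeds (src := src) (tgt := tgt) κ
  have hdense : Dense (Ψ ⁻¹' {r | MvPolynomial.eval r F ≠ 0}) := by
    have h1 := DenseRange.dense_image (Function.Surjective.denseRange fun r => ⟨Ψ r, hΦΨ r⟩)
      hΦ (dense_eval_ne_zero hF)
    refine h1.mono ?_
    rintro _ ⟨r, hr, rfl⟩
    exact hr
  have hopen : IsOpen (Ψ ⁻¹' {r | MvPolynomial.eval r F ≠ 0}) :=
    (isOpen_ne_fun (MvPolynomial.continuous_eval F) continuous_const).preimage hΨ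
  rcases h with h | h
  · right
    refine hdense.mono (interior_maximal ?_ hopen)
    intro r hr hE
    exact hr (h (Ψ r) hE)
  · left
    have h1 : Dense {r : ∀ a, Matrix (I (tgt a)) (I (src a)) ℂ | Embeds src tgt κ r} :=
      hdense.mono fun r hr => h (Ψ r) hr
    intro r
    have h2 := h1.closure_eq
    rw [(isClosed_embeds hκ).closure_eq] at h2
    have h3 := Set.mem_univ r
    rw [← h2] at h3
    exact h3

theorem isIntersecting_of_interior {κ : ∀ x, J x → I x} (hκ : ∀ x, Monotone (κ x))
    (h : (interior {r : ∀ a, Matrix (I (tgt a)) (I (src a)) ℂ |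
      Embeds src tgt κ r}).Nonempty) : IsIntersecting src tgt κ := by
  refine (isIntersecting_or_dense hκ).resolve_right fun hd => ?_
  obtain ⟨r, hr, hr'⟩ := hd.inter_open_nonempty _ isOpen_interior h
  have h1 := interior_subset hr
  have h2 := interior_subset hr'
  exact h2 h1

end Dichotomy

section Chart

variable {V A : Type} {src tgt : A → V}
variable {I : V → Type} [∀ x, LinearOrder (I x)] [∀ x, Fintype (I x)]

/-- The positions of the unipotent parameters of the Schubert cell of `L`. -/
def IsCellPos (L : ∀ x, Finset (I x)) (s : Σ x, I x × I x) : Prop :=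
  s.2.1 ∉ L s.1 ∧ s.2.2 ∈ L s.1 ∧ s.2.1 < s.2.2

/-- The positions of the entries of representations preserving the coordinate subspaces of
`L`. -/
def IsStablePos (src tgt : A → V) (L : ∀ x, Finset (I x))
    (s : Σ a, I (tgt a) × I (src a)) : Prop :=
  ¬ (s.2.1 ∉ L (tgt s.1) ∧ s.2.2 ∈ L (src s.1))

/-- Conjugation of a representation by the unipotent elements `1 + N`. -/
def unipotentConj (src tgt : A → V)
    (p : ((Σ x, I x × I x) → ℂ) × ((Σ a, I (tgt a) × I (src a)) → ℂ)) :
    (Σ a, I (tgt a) × I (src a)) → ℂ := fun s =>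
  ((1 + (.of fun i l => p.1 ⟨tgt s.1, i, l⟩ : Matrix (I (tgt s.1)) (I (tgt s.1)) ℂ)) *
    (.of fun i j => p.2 ⟨s.1, i, j⟩ : Matrix (I (tgt s.1)) (I (src s.1)) ℂ) *
    (1 - (.of fun i l => p.1 ⟨src s.1, i, l⟩ : Matrix (I (src s.1)) (I (src s.1)) ℂ)) :
    Matrix (I (tgt s.1)) (I (src s.1)) ℂ) s.2.1 s.2.2

/-- The inclusion matrix of the coordinates in `L`. -/
def colIncl {I : Type} [DecidableEq I] (L : Finset I) : Matrix I L ℂ :=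
  fun i l => if i = (l : I) then 1 else 0

theorem mul_colIncl {I m : Type} [DecidableEq I] [Fintype I] (L : Finset I) (M : Matrix m I ℂ) :
    M * colIncl L = .of fun i (l : L) => M i l := by
  ext i l
  simp [colIncl, Matrix.mul_apply]

theorem rowProj_mul_colIncl {I : Type} [DecidableEq I] [Fintype I] (L : Finset I) :
    rowProj L * colIncl L = 1 := by
  ext l l'
  rw [rowProj_mul]
  simp [colIncl, Matrix.one_apply]

theorem colIncl_mul_rowProj_mul {I m : Type} [DecidableEq I] [Fintype I] (L : Finset I)
    (M : Matrix I m ℂ) (hM : ∀ i ∉ L, ∀ c, M i c = 0) : colIncl L * (rowProj L * M) = M := by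
  ext i c
  rw [Matrix.mul_apply]
  simp only [rowProj_mul]
  by_cases hi : i ∈ L
  · rw [Finset.sum_eq_single ⟨i, hi⟩]
    · simp [colIncl]
    · intro l _ hl
      have : i ≠ l := fun h => hl (Subtype.ext h.symm)
      simp [colIncl, this]
    · simp
  · rw [hM i hi]
    refine Finset.sum_eq_zero fun l _ => ?_
    have : i ≠ l := fun h => hi (h ▸ l.2)
    simp [colIncl, this]

theorem embeds_unipotentConj {L : ∀ x, Finset (I x)} {n : (Σ x, I x × I x) → ℂ}
    {z : (Σ a, I (tgt a) × I (src a)) → ℂ} (hn : n ∈ coordSubspace (IsCellPos L))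
    (hz : z ∈ coordSubspace (IsStablePos src tgt L)) :
    Embeds src tgt (fun x (l : L x) => (l : I x))
      (fun a => .of fun i j => unipotentConj src tgt (n, z) ⟨a, i, j⟩) := by
  let N : ∀ x, Matrix (I x) (I x) ℂ := fun x => .of fun i l => n ⟨x, i, l⟩
  let Z : ∀ a, Matrix (I (tgt a)) (I (src a)) ℂ := fun a => .of fun i l => z ⟨a, i, l⟩
  have hN : ∀ x, (1 - N x) * (1 + N x) = 1 := by
    intro x
    have : N x * N x = 0 := by
      ext i l
      rw [Matrix.mul_apply]
      refine Finset.sum_eq_zero fun k _ => ?_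
      by_cases hk : k ∈ L x
      · have : n ⟨x, k, l⟩ = 0 := hn _ fun h => h.1 hk
        simp [N, this]
      · have : n ⟨x, i, k⟩ = 0 := hn _ fun h => hk h.2.1
        simp [N, this]
    rw [sub_mul, mul_add, mul_add, this]
    simp
  refine ⟨fun a => rowProj (L (tgt a)) * (Z a * colIncl (L (src a))),
    fun x => (1 + N x) * colIncl (L x), fun x => rowProj (L x) * (1 - N x), ?_, ?_, ?_⟩
  · intro x i l hl
    have h1 : n ⟨x, i, l⟩ = 0 := hn _ fun h => h.2.2.not_gt hl
    show ((1 + N x) * colIncl (L x) : Matrix (I x) (L x) ℂ) i l = 0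
    rw [mul_colIncl]
    simp [N, h1, Matrix.one_apply, hl.ne']
  · intro x
    rw [Matrix.mul_assoc, ← Matrix.mul_assoc (1 - N x), hN, Matrix.one_mul]
    exact rowProj_mul_colIncl _
  · intro a
    show (1 + N (tgt a)) * Z a * (1 - N (src a)) * ((1 + N (src a)) * colIncl (L (src a))) = _
    rw [Matrix.mul_assoc, ← Matrix.mul_assoc (1 - N _), hN, Matrix.one_mul, Matrix.mul_assoc,
      Matrix.mul_assoc, colIncl_mul_rowProj_mul]
    intro i hi l
    rw [mul_colIncl]
    exact hz ⟨a, i, l⟩ fun h => h ⟨hi, l.2⟩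

theorem exists_unipotentConj_eq {r : ∀ a, Matrix (I (tgt a)) (I (src a)) ℂ}
    {L : ∀ x, Finset (I x)}
    {ι : ∀ x, Matrix (I x) (L x) ℂ} (hι : ∀ x, IsEchelon (L x) (ι x))
    (hr : IsSubrep r fun x => LinearMap.range (ι x).mulVecLin) :
    ∃ n ∈ coordSubspace (IsCellPos L), ∃ z ∈ coordSubspace (IsStablePos src tgt L),
      ∀ s, unipotentConj src tgt (n, z) s = r s.1 s.2.1 s.2.2 := by
  let N : ∀ x, Matrix (I x) (I x) ℂ := fun x => (ι x - colIncl (L x)) * rowProj (L x)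
  let Z : ∀ a, Matrix (I (tgt a)) (I (src a)) ℂ := fun a =>
    (1 - N (tgt a)) * r a * (1 + N (src a))
  have hNc : ∀ x, N x * colIncl (L x) = ι x - colIncl (L x) := by
    intro x
    rw [Matrix.mul_assoc, rowProj_mul_colIncl, Matrix.mul_one]
  have hNι : ∀ x, N x * ι x = ι x - colIncl (L x) := by
    intro x
    rw [Matrix.mul_assoc, (hι x).rowProj_mul_self, Matrix.mul_one]
  have hNN : ∀ x, N x * N x = 0 := by
    intro x
    show N x * ((ι x - colIncl (L x)) * rowProj (L x)) = 0
    rw [← Matrix.mul_assoc, Matrix.mul_sub, hNι, hNc, sub_self, Matrix.zero_mul]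
  have hN : ∀ x, (1 + N x) * (1 - N x) = 1 := by
    intro x
    rw [mul_sub, add_mul, add_mul, hNN]
    simp
  have hNapp : ∀ x i (l : I x) (hl : l ∈ L x),
      N x i l = ι x i ⟨l, hl⟩ - if i = l then 1 else 0 := by
    intro x i l hl
    have := congrFun (congrFun (hNc x) i) ⟨l, hl⟩
    rw [mul_colIncl] at this
    simpa [colIncl] using this
  refine ⟨fun s => N s.1 s.2.1 s.2.2, ?_, fun s => Z s.1 s.2.1 s.2.2, ?_, ?_⟩
  · rintro ⟨x, i, l⟩ h
    by_cases hl : l ∈ L x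
    · show N x i l = 0
      rw [hNapp x i l hl]
      by_cases hi : i ∈ L x
      · have := (hι x).pivot ⟨i, hi⟩ ⟨l, hl⟩
        simp only at this
        rw [this]
        simp
      · have hlt : l < i := by
          refine lt_of_le_of_ne (not_lt.1 fun hlt => h ⟨hi, hl, hlt⟩) ?_
          rintro rfl
          exact hi hl
        have := (hι x).below i ⟨l, hl⟩ hlt
        rw [this, if_neg hlt.ne', sub_zero]
    · show N x i l = 0
      simp only [N, Matrix.mul_apply]
      refine Finset.sum_eq_zero fun k _ => ?_
      have : (k : I x) ≠ l := fun h => hl (h ▸ k.2)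
      simp [rowProj, this]
  · rintro ⟨a, i, l⟩ h
    simp only [IsStablePos, not_not] at h
    have h1 : Z a * colIncl (L (src a)) =
        colIncl (L (tgt a)) * (rowProj (L (tgt a)) * r a * ι (src a)) := by
      have h2 : (1 + N (src a)) * colIncl (L (src a)) = ι (src a) := by
        rw [Matrix.add_mul, hNc, Matrix.one_mul]; abel
      have h3 : (1 - N (tgt a)) * ι (tgt a) = colIncl (L (tgt a)) := by
        rw [Matrix.sub_mul, hNι, Matrix.one_mul]; abel
      rw [Matrix.mul_assoc, h2, Matrix.mul_assoc, mul_eq_of_isSubrep hι hr, ← Matrix.mul_assoc, h3]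
    have h4 := congrFun (congrFun h1 i) ⟨l, h.2⟩
    rw [mul_colIncl, Matrix.mul_apply] at h4
    refine Eq.trans h4 (Finset.sum_eq_zero fun k _ => ?_)
    have : i ≠ (k : I (tgt a)) := fun h' => h.1 (h' ▸ k.2)
    simp [colIncl, this]
  · rintro ⟨a, i, j⟩
    show ((1 + N (tgt a)) * Z a * (1 - N (src a)) : Matrix (I (tgt a)) (I (src a)) ℂ) i j = r a i j
    have : (1 + N (tgt a)) * Z a * (1 - N (src a)) = r a := by
      calc (1 + N (tgt a)) * Z a * (1 - N (src a))
          = ((1 + N (tgt a)) * (1 - N (tgt a))) * r a * ((1 + N (src a)) * (1 - N (src a))) := by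
            simp only [Z, Matrix.mul_assoc]
        _ = r a := by rw [hN, hN, Matrix.one_mul, Matrix.mul_one]
    rw [this]

variable [Fintype V] [Fintype A]

theorem contDiff_unipotentConj (𝕜 : Type) [RCLike 𝕜] [NormedAlgebra 𝕜 ℂ] (src tgt : A → V) :
    ContDiff 𝕜 1 (unipotentConj (I := I) src tgt) := by
  rw [contDiff_pi]
  rintro ⟨a, i, j⟩
  simp only [unipotentConj, Matrix.mul_apply, Matrix.add_apply, Matrix.sub_apply,
    Matrix.of_apply]
  fun_prop

end Chart

section ExpectedDimension

variable {V A : Type} {src tgt : A → V}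
variable {J I : V → Type} [∀ x, LinearOrder (J x)] [∀ x, Fintype (J x)]
  [∀ x, LinearOrder (I x)] [∀ x, Fintype (I x)]

theorem finrank_isCellPos [Fintype V] (L : ∀ x, Finset (I x)) :
    (Module.finrank ℂ (coordSubspace (IsCellPos L)) : ℤ) =
      ∑ x, ∑ l : L x, (((Finset.univ.filter (· < (l : I x))).card : ℤ) -
        ((Finset.univ.filter (· < l)).card : ℤ)) := by
  classical
  rw [finrank_coordSubspace, Finset.card_filter, Fintype.sum_sigma]
  push_cast
  refine Finset.sum_congr rfl fun x _ => ?_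
  rw [Fintype.sum_prod_type_right]
  have h1 : ∀ l : L x, ((Finset.univ.filter (· < (l : I x))).card : ℤ) -
      ((Finset.univ.filter (· < l)).card : ℤ) =
      ∑ i, if IsCellPos L ⟨x, i, l⟩ then (1 : ℤ) else 0 := by
    intro l
    have h2 : (Finset.univ.filter (· < l)).card =
        (Finset.univ.filter fun i => i < (l : I x) ∧ i ∈ L x).card := by
      rw [← Finset.card_map (Function.Embedding.subtype _)]
      congr 1
      ext i
      simp only [Finset.mem_map, Finset.mem_filter, Finset.mem_univ, true_and,
        Function.Embedding.subtype_apply, Subtype.exists]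
      exact ⟨fun ⟨k, hk, hkl, h⟩ => h ▸ ⟨hkl, hk⟩, fun ⟨h, hi⟩ => ⟨i, hi, h, rfl⟩⟩
    have h3 := Finset.card_filter_add_card_filter_not
      (s := Finset.univ.filter (· < (l : I x))) (· ∈ L x)
    rw [Finset.filter_filter, Finset.filter_filter] at h3
    rw [h2, ← h3, Finset.sum_boole]
    push_cast
    rw [add_sub_cancel_left]
    congr 2
    ext i
    simp [IsCellPos, and_comm]
  rw [Finset.sum_congr rfl fun l _ => h1 l,
    Finset.sum_coe_sort (L x) fun l => ∑ i, if IsCellPos L ⟨x, i, l⟩ then (1 : ℤ) else 0]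
  refine (Finset.sum_subset (Finset.subset_univ _) fun l _ hl => ?_).symm
  exact Finset.sum_eq_zero fun i _ => if_neg fun h => hl h.2.1

theorem finrank_isStablePos [Fintype A] (L : ∀ x, Finset (I x)) :
    (Module.finrank ℂ (coordSubspace (IsStablePos src tgt L)) : ℤ) =
      Fintype.card (Σ a, I (tgt a) × I (src a)) -
      ∑ a, (Fintype.card (L (src a)) : ℤ) *
      ((Fintype.card (I (tgt a)) : ℤ) - (Fintype.card (L (tgt a)) : ℤ)) := by
  classical
  have h := Finset.card_filter_add_card_filter_not (s := Finset.univ) (IsStablePos src tgt L)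
  have h2 : ((Finset.univ.filter fun s => ¬ IsStablePos src tgt L s).card : ℤ) =
      ∑ a, (Fintype.card (L (src a)) : ℤ) *
      ((Fintype.card (I (tgt a)) : ℤ) - (Fintype.card (L (tgt a)) : ℤ)) := by
    rw [Finset.card_filter, Fintype.sum_sigma]
    push_cast
    refine Finset.sum_congr rfl fun a _ => ?_
    have h3 : ∀ s : I (tgt a) × I (src a), ¬ IsStablePos src tgt L ⟨a, s⟩ ↔
        s ∈ (L (tgt a))ᶜ ×ˢ L (src a) := by
      intro s
      simp [IsStablePos]
    simp only [h3, Finset.sum_boole, Finset.filter_mem_eq_inter, Finset.univ_inter,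
      Finset.card_product, Finset.card_compl, Fintype.card_coe]
    rw [mul_comm]
    push_cast [Finset.card_le_univ]
    rfl
  rw [finrank_coordSubspace, ← h2, ← Finset.card_univ, ← h]
  push_cast
  ring

variable [Fintype V] [Fintype A]

theorem finrank_chart (L : ∀ x, Finset (I x)) :
    (Module.finrank ℂ (coordSubspace (IsCellPos L) × coordSubspace (IsStablePos src tgt L)) : ℤ) =
      edim src tgt (fun x (l : L x) => (l : I x)) +
        Fintype.card (Σ a, I (tgt a) × I (src a)) := by
  rw [Module.finrank_prod]
  push_cast
  rw [finrank_isCellPos, finrank_isStablePos, edim]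
  ring

theorem edim_le_edim_of_le {κ : ∀ x, J x → I x} {L : ∀ x, Finset (I x)} (e : ∀ x, J x ≃o L x)
    (he : ∀ x j, (e x j : I x) ≤ κ x j) :
    edim src tgt (fun x (l : L x) => (l : I x)) ≤ edim src tgt κ := by
  rw [← edim_congr _ e]
  refine sub_le_sub_right (Finset.sum_le_sum fun x _ => Finset.sum_le_sum fun j _ =>
    sub_le_sub_right ?_ _) _
  have : (Finset.univ.filter (· < (e x j : I x))).card ≤ (Finset.univ.filter (· < κ x j)).card := by
    refine Finset.card_le_card fun i hi => ?_
    simp only [Finset.mem_filter, Finset.mem_univ, true_and] at hi ⊢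
    exact hi.trans_le (he x j)
  exact_mod_cast this

theorem IsIntersecting.edim_nonneg {κ : ∀ x, J x → I x} (hκ : ∀ x, Monotone (κ x))
    (h : IsIntersecting src tgt κ) : 0 ≤ edim src tgt κ := by
  classical
  by_contra! hneg
  let ℒ := {L : ∀ x, Finset (I x) // edim src tgt (fun x (l : L x) => (l : I x)) < 0}
  let σ := Σ a, I (tgt a) × I (src a)
  let f : ∀ L : ℒ, coordSubspace (IsCellPos L.1) × coordSubspace (IsStablePos src tgt L.1) →
      (σ → ℂ) := fun L p => unipotentConj src tgt (p.1, p.2)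
  have hcov : ∀ r : σ → ℂ, ∃ L, r ∈ Set.range (f L) := by
    intro r
    obtain ⟨L, ι, hι, hr, e, he⟩ :=
      (h fun a => .of fun i j => r ⟨a, i, j⟩).exists_isEchelon hκ
    obtain ⟨n, hn, z, hz, hnz⟩ := exists_unipotentConj_eq hι hr
    exact ⟨⟨L, (edim_le_edim_of_le e he).trans_lt hneg⟩, (⟨n, hn⟩, ⟨z, hz⟩), funext hnz⟩
  have hdim : ∀ L : ℒ, dimH (Set.range (f L)) ≤ ((Module.finrank ℝ (σ → ℂ) - 1 : ℕ) : ENNReal) := by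
    intro L
    have h1 : ContDiff ℝ 1 (f L) := (contDiff_unipotentConj ℝ src tgt).comp
      (((coordSubspace (IsCellPos L.1)).subtypeL.restrictScalars ℝ).prodMap
        ((coordSubspace (IsStablePos src tgt L.1)).subtypeL.restrictScalars ℝ)).contDiff
    refine h1.dimH_range_le.trans ?_
    have h2 := finrank_chart (src := src) (tgt := tgt) L.1
    have h3 := L.2
    have h4 : Module.finrank ℂ (σ → ℂ) = Fintype.card σ := Module.finrank_fintype_fun_eq_card ℂ
    rw [finrank_real_of_complex, finrank_real_of_complex, h4]
    have h5 : 2 * Module.finrank ℂ (coordSubspace (IsCellPos L.1) ×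
      coordSubspace (IsStablePos src tgt L.1)) ≤ 2 * Fintype.card σ - 1 := by
      simp only [σ]
      omega
    exact_mod_cast h5
  have hpos : 0 < Module.finrank ℝ (σ → ℂ) := by
    obtain ⟨L, -⟩ := hcov 0
    have h2 := finrank_chart (src := src) (tgt := tgt) L.1
    have h3 := L.2
    have h4 : Module.finrank ℂ (σ → ℂ) = Fintype.card σ := Module.finrank_fintype_fun_eq_card ℂ
    rw [finrank_real_of_complex, h4]
    simp only [σ]
    omega
  have huniv : (Set.univ : Set (σ → ℂ)) = ⋃ L, Set.range (f L) := by
    ext r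
    simpa using hcov r
  have h1 := Real.dimH_univ_eq_finrank (σ → ℂ)
  rw [huniv, dimH_iUnion] at h1
  have h2 := iSup_le hdim
  rw [h1] at h2
  have h3 : Module.finrank ℝ (σ → ℂ) ≤ Module.finrank ℝ (σ → ℂ) - 1 := by exact_mod_cast h2
  omega

end ExpectedDimension

section Hom

variable {V A : Type} {src tgt : A → V}
variable {J W : V → Type} [∀ x, Fintype (J x)] [∀ x, Fintype (W x)]

/-- Families of matrices supported on the positions allowed by `R`. -/
def homSpace (R : ∀ x, W x → J x → Prop) : Submodule ℂ (∀ x, Matrix (W x) (J x) ℂ) where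
  carrier := {φ | ∀ x w j, ¬ R x w j → φ x w j = 0}
  add_mem' := by
    intro φ ψ hφ hψ x w j h
    simp [hφ x w j h, hψ x w j h]
  zero_mem' := by intro x w j _; rfl
  smul_mem' := by
    intro c φ hφ x w j h
    simp [hφ x w j h]

/-- The commutator map `φ ↦ w φ - φ u`, as a linear function of the pair `(u, w)`. -/
def homCommutator (src tgt : A → V) (R : ∀ x, W x → J x → Prop) :
    ((∀ a, Matrix (J (tgt a)) (J (src a)) ℂ) × (∀ a, Matrix (W (tgt a)) (W (src a)) ℂ)) →ₗ[ℂ]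
      homSpace R →ₗ[ℂ] ∀ a, Matrix (W (tgt a)) (J (src a)) ℂ :=
  LinearMap.mk₂ ℂ (fun p φ a => p.2 a * φ.1 (src a) - φ.1 (tgt a) * p.1 a)
    (fun p q φ => by
      funext a
      simp only [Prod.fst_add, Prod.snd_add, Pi.add_apply, Matrix.add_mul, Matrix.mul_add]
      abel)
    (fun c p φ => by
      funext a
      simp only [Prod.smul_fst, Prod.smul_snd, Pi.smul_apply, Matrix.smul_mul, Matrix.mul_smul,
        smul_sub])
    (fun p φ ψ => by
      funext a
      simp only [Submodule.coe_add, Pi.add_apply, Matrix.add_mul, Matrix.mul_add]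
      abel)
    (fun c p φ => by
      funext a
      simp only [Submodule.coe_smul, Pi.smul_apply, Matrix.smul_mul, Matrix.mul_smul, smul_sub])

theorem homCommutator_apply (R : ∀ x, W x → J x → Prop)
    (u : ∀ a, Matrix (J (tgt a)) (J (src a)) ℂ) (w : ∀ a, Matrix (W (tgt a)) (W (src a)) ℂ)
    (φ : homSpace R) (a : A) :
    homCommutator src tgt R (u, w) φ a = w a * φ.1 (src a) - φ.1 (tgt a) * u a := rfl

end Hom

section Submersion

variable {V A : Type} {src tgt : A → V}
variable {I : V → Type} [∀ x, LinearOrder (I x)] [∀ x, Fintype (I x)]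

/-- The derivative of `unipotentConj` at a point with trivial unipotent part. -/
theorem hasDerivAt_unipotentConj (z₀ z : (Σ a, I (tgt a) × I (src a)) → ℂ)
    (n : (Σ x, I x × I x) → ℂ) :
    HasDerivAt (fun t : ℂ => unipotentConj src tgt (t • n, z₀ + t • z))
      (fun s => (∑ l, n ⟨tgt s.1, s.2.1, l⟩ * z₀ ⟨s.1, l, s.2.2⟩) -
        (∑ l, z₀ ⟨s.1, s.2.1, l⟩ * n ⟨src s.1, l, s.2.2⟩) + z s) 0 := by
  rw [hasDerivAt_pi]
  rintro ⟨a, i, j⟩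
  let N : ∀ x, Matrix (I x) (I x) ℂ := fun x => .of fun i l => n ⟨x, i, l⟩
  let Z₀ : Matrix (I (tgt a)) (I (src a)) ℂ := .of fun i l => z₀ ⟨a, i, l⟩
  let Z : Matrix (I (tgt a)) (I (src a)) ℂ := .of fun i l => z ⟨a, i, l⟩
  let T₁ : Matrix (I (tgt a)) (I (src a)) ℂ := N (tgt a) * Z₀ - Z₀ * N (src a) + Z
  let T₂ : Matrix (I (tgt a)) (I (src a)) ℂ :=
    N (tgt a) * Z - Z * N (src a) - N (tgt a) * Z₀ * N (src a)
  let T₃ : Matrix (I (tgt a)) (I (src a)) ℂ := N (tgt a) * Z * N (src a)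
  have h1 : (fun t : ℂ => unipotentConj src tgt (t • n, z₀ + t • z) ⟨a, i, j⟩) =
      fun t => Z₀ i j + t * T₁ i j + t ^ 2 * T₂ i j - t ^ 3 * T₃ i j := by
    funext t
    have h2 : (1 + t • N (tgt a)) * (Z₀ + t • Z) * (1 - t • N (src a)) =
        Z₀ + t • T₁ + t ^ 2 • T₂ - t ^ 3 • T₃ := by
      simp only [T₁, T₂, T₃, Matrix.add_mul, Matrix.mul_add, Matrix.mul_sub, Matrix.smul_mul,
        Matrix.mul_smul, Matrix.one_mul, Matrix.mul_one, smul_add, smul_sub, smul_smul]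
      generalize N (tgt a) * Z₀ * N (src a) = M₁, N (tgt a) * Z * N (src a) = M₂,
        N (tgt a) * Z₀ = M₃, N (tgt a) * Z = M₄, Z₀ * N (src a) = M₅, Z * N (src a) = M₆
      module
    exact congrFun (congrFun h2 i) j
  rw [h1]
  have h3 : (∑ l, n ⟨tgt a, i, l⟩ * z₀ ⟨a, l, j⟩) - (∑ l, z₀ ⟨a, i, l⟩ * n ⟨src a, l, j⟩) +
      z ⟨a, i, j⟩ = T₁ i j := rfl
  rw [h3]
  have h4 : HasDerivAt (fun t : ℂ => Z₀ i j + t * T₁ i j + t ^ 2 * T₂ i j - t ^ 3 * T₃ i j)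
      (0 + 1 * T₁ i j + ((2 : ℕ) * (0 : ℂ) ^ 1) * T₂ i j - ((3 : ℕ) * (0 : ℂ) ^ 2) * T₃ i j) 0 :=
    ((((hasDerivAt_const _ _).add ((hasDerivAt_id _).mul_const _)).add
      ((hasDerivAt_pow 2 _).mul_const _)).sub ((hasDerivAt_pow 3 _).mul_const _))
  simpa using h4

/-- If some commutator map is surjective then the family `L` is intersecting. -/
theorem isIntersecting_of_surjective [Fintype V] [Fintype A] (L : ∀ x, Finset (I x))
    (u : ∀ a, Matrix (L (tgt a)) (L (src a)) ℂ)
    (w : ∀ a, Matrix {i // i ∉ L (tgt a)} {i // i ∉ L (src a)} ℂ)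
    (h : Function.Surjective (homCommutator src tgt (J := fun x => L x)
      (W := fun x => {i // i ∉ L x})
      (fun x i l => (i : I x) < l) (u, w))) :
    IsIntersecting src tgt fun x (l : L x) => (l : I x) := by
  classical
  let σ := Σ a, I (tgt a) × I (src a)
  let z₀ : σ → ℂ := fun s =>
    if hi : s.2.1 ∈ L (tgt s.1) then
      if hj : s.2.2 ∈ L (src s.1) then u s.1 ⟨_, hi⟩ ⟨_, hj⟩ else 0
    else if hj : s.2.2 ∈ L (src s.1) then 0 else w s.1 ⟨_, hi⟩ ⟨_, hj⟩
  have hz₀ : z₀ ∈ coordSubspace (IsStablePos src tgt L) := by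
    rintro ⟨a, i, j⟩ hs
    have hs := not_not.1 hs
    exact (dif_neg hs.1).trans (dif_pos hs.2)
  let E := coordSubspace (IsCellPos L) × coordSubspace (IsStablePos src tgt L)
  let f : E → (σ → ℂ) := fun p => unipotentConj src tgt (p.1, p.2)
  let p₀ : E := (0, ⟨z₀, hz₀⟩)
  have hf : ContDiff ℂ 1 f := (contDiff_unipotentConj ℂ src tgt).comp
      ((coordSubspace (IsCellPos L)).subtypeL.prodMap
        (coordSubspace (IsStablePos src tgt L)).subtypeL).contDiff
  have hstrict := hf.contDiffAt.hasStrictFDerivAt (x := p₀) one_ne_zero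
  have hline : ∀ v : E, fderiv ℂ f p₀ v = fun s =>
      (∑ l, v.1.1 ⟨tgt s.1, s.2.1, l⟩ * z₀ ⟨s.1, l, s.2.2⟩) -
        (∑ l, z₀ ⟨s.1, s.2.1, l⟩ * v.1.1 ⟨src s.1, l, s.2.2⟩) + v.2.1 s := by
    intro v
    have h1 := hstrict.hasFDerivAt.hasLineDerivAt v
    refine HasDerivAt.unique h1 ?_
    have h2 : (fun t : ℂ => f (p₀ + t • v)) =
        fun t => unipotentConj src tgt (t • v.1.1, z₀ + t • v.2.1) := by
      funext t
      change unipotentConj src tgt (0 + t • v.1.1, z₀ + t • v.2.1) = _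
      rw [zero_add]
    rw [h2]
    exact hasDerivAt_unipotentConj z₀ v.2.1 v.1.1
  have hsurj : (fderiv ℂ f p₀).range = ⊤ := by
    rw [LinearMap.range_eq_top]
    intro ρ
    obtain ⟨φ, hφ⟩ := h fun a => .of fun i j => - ρ ⟨a, i, j⟩
    let n : (Σ x, I x × I x) → ℂ := fun s =>
      if hs : s.2.1 ∉ L s.1 ∧ s.2.2 ∈ L s.1 then φ.1 s.1 ⟨_, hs.1⟩ ⟨_, hs.2⟩ else 0
    have hn : n ∈ coordSubspace (IsCellPos L) := by
      rintro ⟨x, i, l⟩ hs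
      simp only [n]
      split_ifs with h'
      · exact φ.2 _ _ _ fun hlt => hs ⟨h'.1, h'.2, hlt⟩
      · rfl
    let z : σ → ℂ := fun s => if IsStablePos src tgt L s then
      ρ s - ((∑ l, n ⟨tgt s.1, s.2.1, l⟩ * z₀ ⟨s.1, l, s.2.2⟩) -
        (∑ l, z₀ ⟨s.1, s.2.1, l⟩ * n ⟨src s.1, l, s.2.2⟩)) else 0
    have hz : z ∈ coordSubspace (IsStablePos src tgt L) := fun s hs => if_neg hs
    refine ⟨(⟨n, hn⟩, ⟨z, hz⟩), (hline _).trans ?_⟩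
    funext s
    by_cases hs : IsStablePos src tgt L s
    · simp [z, hs]
    · obtain ⟨a, i, j⟩ := s
      simp only [z, hs, if_false, add_zero]
      have hs := not_not.1 hs
      have h1 := congrFun (congrFun (congrFun hφ a) ⟨i, hs.1⟩) ⟨j, hs.2⟩
      rw [homCommutator_apply] at h1
      simp only [Matrix.sub_apply, Matrix.mul_apply, Matrix.of_apply] at h1
      have h2 : ∑ l, n ⟨tgt a, i, l⟩ * z₀ ⟨a, l, j⟩ =
          ∑ l : L (tgt a), φ.1 (tgt a) ⟨i, hs.1⟩ l * u a l ⟨j, hs.2⟩ := by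
        rw [← Finset.sum_subset (Finset.subset_univ (L (tgt a))), ← Finset.sum_coe_sort]
        · refine Finset.sum_congr rfl fun l _ => ?_
          simp [n, z₀, hs.1, hs.2]
        · intro l _ hl
          simp [n, hl]
      have h3 : ∑ l, z₀ ⟨a, i, l⟩ * n ⟨src a, l, j⟩ =
          ∑ l : {i // i ∉ L (src a)}, w a ⟨i, hs.1⟩ l * φ.1 (src a) l ⟨j, hs.2⟩ := by
        rw [← Finset.sum_subset (Finset.subset_univ (L (src a))ᶜ),
          Finset.sum_subtype (p := fun l => l ∉ L (src a)) _ (by simp)]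
        · refine Finset.sum_congr rfl fun l _ => ?_
          simp [n, z₀, hs.1, hs.2, l.2]
        · intro l _ hl
          simp only [Finset.mem_compl, not_not] at hl
          simp [n, hl]
      rw [h2, h3, ← neg_inj, ← h1]
      ring
  have hnhds := hstrict.map_nhds_eq_of_surj hsurj
  let Φ : (∀ a, Matrix (I (tgt a)) (I (src a)) ℂ) → σ → ℂ := fun r s => r s.1 s.2.1 s.2.2
  have hΦ : Continuous Φ := continuous_pi fun z => (continuous_apply z.1).matrix_elem _ _
  refine isIntersecting_of_interior (fun x => (Subtype.strictMono_coe _).monotone)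
    ⟨fun a => .of fun i j => f p₀ ⟨a, i, j⟩, ?_⟩
  rw [mem_interior_iff_mem_nhds]
  have h1 : Set.range f ∈ nhds (f p₀) := by
    rw [← hnhds]
    exact Filter.range_mem_map
  refine Filter.mem_of_superset (hΦ.continuousAt.preimage_mem_nhds h1) ?_
  rintro r ⟨p, hp⟩
  have h2 := embeds_unipotentConj (src := src) (tgt := tgt) p.1.2 p.2.2
  have h3 : (fun a => .of fun i j => unipotentConj src tgt (p.1.1, p.2.1) ⟨a, i, j⟩ :
      ∀ a, Matrix (I (tgt a)) (I (src a)) ℂ) = r := by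
    funext a
    ext i j
    exact congrFun hp ⟨a, i, j⟩
  rw [h3] at h2
  exact h2

end Submersion

section Rank

variable {X Y : Type} [AddCommGroup X] [Module ℂ X] [AddCommGroup Y] [Module ℂ Y]
  [FiniteDimensional ℂ X]

/-- The rank of `T₀` is detected by a minor. -/
theorem exists_minor (T₀ : X →ₗ[ℂ] Y) :
    ∃ (r : ℕ) (g : (X →ₗ[ℂ] Y) →ₗ[ℂ] Matrix (Fin r) (Fin r) ℂ),
      Module.finrank ℂ (LinearMap.range T₀) = r ∧ (g T₀).det ≠ 0 ∧
      ∀ T, (g T).det ≠ 0 → r ≤ Module.finrank ℂ (LinearMap.range T) := by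
  let B := LinearMap.range T₀
  obtain ⟨π, hπ⟩ := LinearMap.exists_leftInverse_of_injective B.subtype B.ker_subtype
  obtain ⟨s, hs⟩ := LinearMap.exists_rightInverse_of_surjective T₀.rangeRestrict
    T₀.range_rangeRestrict
  let b := Module.finBasis ℂ B
  refine ⟨_, (LinearMap.toMatrix b b).toLinearMap ∘ₗ LinearMap.llcomp ℂ B Y B π ∘ₗ
    LinearMap.lcomp ℂ Y s, rfl, ?_, ?_⟩
  · have h1 : π ∘ₗ T₀ ∘ₗ s = LinearMap.id := by
      rw [← hπ]
      ext v
      have h2 : T₀ (s v) = v := congrArg Subtype.val (LinearMap.congr_fun hs v)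
      simp [h2]
    change (LinearMap.toMatrix b b (π ∘ₗ T₀ ∘ₗ s)).det ≠ 0
    rw [h1, LinearMap.toMatrix_id, Matrix.det_one]
    exact one_ne_zero
  · intro T hT
    change (LinearMap.toMatrix b b (π ∘ₗ T ∘ₗ s)).det ≠ 0 at hT
    rw [LinearMap.det_toMatrix] at hT
    have h1 : Function.Injective (π ∘ₗ T ∘ₗ s) := (LinearMap.equivOfDetNeZero _ hT).injective
    have h2 : Function.Injective (T ∘ₗ s) := by
      rw [LinearMap.coe_comp] at h1
      exact h1.of_comp
    rw [← LinearMap.finrank_range_of_inj h2]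
    exact Submodule.finrank_mono (LinearMap.range_comp_le_range _ _)

theorem finite_finrank_range_lt (T₀ T₁ : X →ₗ[ℂ] Y) (t₀ : ℂ) :
    {t : ℂ | Module.finrank ℂ (LinearMap.range (T₀ + t • T₁)) <
      Module.finrank ℂ (LinearMap.range (T₀ + t₀ • T₁))}.Finite := by
  obtain ⟨r, g, hr, h0, hg⟩ := exists_minor (T₀ + t₀ • T₁)
  let q : Polynomial ℂ :=
    ((Polynomial.X : Polynomial ℂ) • (g T₁).map Polynomial.C + (g T₀).map Polynomial.C).det
  have hq : ∀ t, q.eval t = (g (T₀ + t • T₁)).det := by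
    intro t
    rw [← Polynomial.coe_evalRingHom, RingHom.map_det]
    congr 1
    ext i j
    simp [add_comm, mul_comm t]
  have hq0 : q ≠ 0 := by
    intro h
    rw [← hq, h, Polynomial.eval_zero] at h0
    exact h0 rfl
  refine (Polynomial.finite_setOfPred_isRoot hq0).subset fun t ht => ?_
  by_contra h
  rw [hr] at ht
  refine absurd (hg (T₀ + t • T₁) ?_) (not_le.2 ht)
  rwa [← hq]

variable {P : Type} [AddCommGroup P] [Module ℂ P] [TopologicalSpace P] [IsTopologicalAddGroup P]
  [ContinuousSMul ℂ P]

theorem dense_finrank_range_le (M : P →ₗ[ℂ] X →ₗ[ℂ] Y) (p₁ : P) :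
    Dense {p | Module.finrank ℂ (LinearMap.range (M p₁)) ≤
      Module.finrank ℂ (LinearMap.range (M p))} := by
  intro p₀
  have hfin := finite_finrank_range_lt (M p₀) (M (p₁ - p₀)) 1
  have hd := Set.Countable.dense_compl ℂ hfin.countable
  have hc : Continuous fun t : ℂ => p₀ + t • (p₁ - p₀) := by fun_prop
  have h := map_mem_closure hc (hd 0) (t := {p | Module.finrank ℂ (LinearMap.range (M p₁)) ≤
      Module.finrank ℂ (LinearMap.range (M p))}) ?_
  · simpa using h
  · intro t ht
    have h1 := not_lt.1 (Set.notMem_ofPred_iff.1 ht)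
    rw [one_smul, ← map_add, add_sub_cancel, ← map_smul, ← map_add] at h1
    exact h1

theorem isOpen_le_finrank_range [T2Space P] [FiniteDimensional ℂ P] (M : P →ₗ[ℂ] X →ₗ[ℂ] Y)
    (n : ℕ) : IsOpen {p | n ≤ Module.finrank ℂ (LinearMap.range (M p))} := by
  rw [isOpen_iff_mem_nhds]
  intro p₀ hp₀
  obtain ⟨r, g, hr, h0, hg⟩ := exists_minor (M p₀)
  have hc : Continuous fun p => (g (M p)).det :=
    (LinearMap.continuous_of_finiteDimensional (g ∘ₗ M)).matrix_det
  refine Filter.mem_of_superset (hc.continuousAt.eventually_ne h0) fun p hp => ?_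
  exact (hr ▸ hp₀ : n ≤ r).trans (hg _ hp)

/-- At a point of maximal rank, the derivative of a linear family of maps sends the kernel into
the range. -/
theorem apply_mem_range_of_finrank_max {P : Type} [AddCommGroup P] [Module ℂ P]
    (M : P →ₗ[ℂ] X →ₗ[ℂ] Y) {p : P}
    (hp : ∀ q, Module.finrank ℂ (LinearMap.range (M q)) ≤ Module.finrank ℂ (LinearMap.range (M p)))
    {φ : X} (hφ : M p φ = 0) (q : P) : M q φ ∈ LinearMap.range (M p) := by
  by_contra hy
  have hφ0 : φ ≠ 0 := by
    rintro rfl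
    simp at hy
  obtain ⟨c, hc⟩ := Module.Projective.exists_dual_eq_one ℂ hφ0
  let T₀ := M p + c.smulRight (M q φ)
  let T₁ := M q - c.smulRight (M q φ)
  have hlt : LinearMap.range (M p) < LinearMap.range (T₀ + (0 : ℂ) • T₁) := by
    refine lt_of_le_of_ne ?_ fun h => hy ?_
    · rintro _ ⟨x, rfl⟩
      refine ⟨x - c x • φ, ?_⟩
      simp [T₀, hφ, hc]
    · rw [h]
      refine ⟨φ, ?_⟩
      simp [T₀, hφ, hc]
  have hfin := (finite_finrank_range_lt T₀ T₁ 0).union (Set.finite_singleton 0)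
  obtain ⟨t, ht⟩ := hfin.infinite_compl.nonempty
  simp only [Set.mem_compl_iff, Set.mem_union, Set.mem_singleton_iff, not_or] at ht
  have h1 := not_lt.1 (Set.notMem_ofPred_iff.1 ht.1)
  have h2 : LinearMap.range (T₀ + t • T₁) ≤ LinearMap.range (M (p + t • q)) := by
    rintro _ ⟨x, rfl⟩
    refine ⟨x + (c x * (t⁻¹ - 1)) • φ, ?_⟩
    have h3 : (c x * (t⁻¹ - 1)) • t • M q φ = c x • M q φ - t • c x • M q φ := by
      rw [smul_smul, smul_smul, ← sub_smul]
      congr 1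
      field_simp [ht.2]
    simp only [map_add, map_smul, LinearMap.add_apply, LinearMap.smul_apply, LinearMap.sub_apply,
      LinearMap.smulRight_apply, hφ, zero_add, T₀, T₁, h3, smul_sub]
    abel
  have h4 := Submodule.finrank_lt_finrank_of_lt hlt
  have h5 := Submodule.finrank_mono h2
  have h6 := hp (p + t • q)
  omega

theorem dense_iInter_of_finite {Z ι : Type} [TopologicalSpace Z] [Finite ι] {s : ι → Set Z}
    (ho : ∀ i, IsOpen (s i)) (hd : ∀ i, Dense (s i)) : Dense (⋂ i, s i) := by
  rw [← Set.sInter_range]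
  refine (Set.finite_range s).dense_sInter ?_ ?_
  · rintro _ ⟨i, rfl⟩
    exact ho i
  · rintro _ ⟨i, rfl⟩
    exact hd i

end Rank

section Generic

variable {V A : Type} {src tgt : A → V}
variable {J W : V → Type} [∀ x, LinearOrder (J x)] [∀ x, Fintype (J x)] [∀ x, Fintype (W x)]

theorem exists_isOpen_dense_forall_surjective [Finite V] [Finite A] {L : V → Type}
    [∀ x, Fintype (L x)] (R : ∀ x, W x → L x → Prop) :
    ∃ D : Set (∀ a, Matrix (W (tgt a)) (W (src a)) ℂ), IsOpen D ∧ Dense D ∧ ∀ w ∈ D,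
      (∃ p, Function.Surjective (homCommutator src tgt R p)) →
      ∃ u, Function.Surjective (homCommutator src tgt R (u, w)) := by
  by_cases h : ∃ p, Function.Surjective (homCommutator src tgt R p)
  · obtain ⟨p, hp⟩ := h
    let U := {q | Module.finrank ℂ (∀ a, Matrix (W (tgt a)) (L (src a)) ℂ) ≤
      Module.finrank ℂ (LinearMap.range (homCommutator src tgt R q))}
    have hU : Dense U := by
      refine (dense_finrank_range_le (homCommutator src tgt R) p).mono fun q hq => ?_
      rw [Set.mem_ofPred, LinearMap.range_eq_top.2 hp, finrank_top] at hq
      exact hq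
    refine ⟨Prod.snd '' U, isOpenMap_snd _ (isOpen_le_finrank_range _ _),
      Prod.snd_surjective.denseRange.dense_image continuous_snd hU, ?_⟩
    rintro _ ⟨⟨u, w⟩, hq, rfl⟩ _
    exact ⟨u, LinearMap.range_eq_top.1
      (Submodule.eq_top_of_finrank_eq (le_antisymm (Submodule.finrank_le _) hq))⟩
  · exact ⟨Set.univ, isOpen_univ, dense_univ, fun _ _ h' => absurd h' h⟩

/-- A pair of representations which is generic for the commutator maps and all their restrictions
to coordinate families, and for Schubert subrepresentations. -/
theorem exists_generic_pair [Finite V] [Finite A] (R : ∀ x, W x → J x → Prop) :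
    ∃ (u : ∀ a, Matrix (J (tgt a)) (J (src a)) ℂ) (w : ∀ a, Matrix (W (tgt a)) (W (src a)) ℂ),
      (∀ q, Module.finrank ℂ (LinearMap.range (homCommutator src tgt R q)) ≤
        Module.finrank ℂ (LinearMap.range (homCommutator src tgt R (u, w)))) ∧
      (∀ L : ∀ x, Finset (J x),
        (∃ p, Function.Surjective (homCommutator src tgt (J := fun x => L x)
          (fun x i l => R x i l) p)) →
        ∃ v, Function.Surjective (homCommutator src tgt (J := fun x => L x)
          (fun x i l => R x i l) (v, w))) ∧
      ∀ L : ∀ x, Finset (J x), Embeds src tgt (fun x (l : L x) => (l : J x)) u →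
        IsIntersecting src tgt fun x (l : L x) => (l : J x) := by
  let rk := fun q => Module.finrank ℂ (LinearMap.range (homCommutator src tgt R q))
  obtain ⟨q₀, hq₀⟩ : ∃ q₀, ∀ q, rk q ≤ rk q₀ := by
    have hfin : (Set.range rk).Finite := by
      refine (Set.finite_Iic (Module.finrank ℂ (homSpace R))).subset ?_
      rintro _ ⟨q, rfl⟩
      exact LinearMap.finrank_range_le _
    obtain ⟨_, ⟨q₀, rfl⟩, h⟩ := Set.exists_max_image _ id hfin ⟨_, Set.mem_range_self 0⟩
    exact ⟨q₀, fun q => h _ (Set.mem_range_self q)⟩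
  have h2 := fun L : ∀ x, Finset (J x) => exists_isOpen_dense_forall_surjective (src := src)
    (tgt := tgt) (W := W) (L := fun x => L x) (fun x i l => R x i l)
  choose D hDo hDd hD using h2
  have h3 : ∀ L : ∀ x, Finset (J x), ∃ D : Set (∀ a, Matrix (J (tgt a)) (J (src a)) ℂ),
      IsOpen D ∧ Dense D ∧ ∀ u ∈ D, Embeds src tgt (fun x (l : L x) => (l : J x)) u →
        IsIntersecting src tgt fun x (l : L x) => (l : J x) := by
    intro L
    rcases isIntersecting_or_dense (src := src) (tgt := tgt) (κ := fun x (l : L x) => (l : J x))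
      (fun x => (Subtype.strictMono_coe _).monotone) with h | h
    · exact ⟨Set.univ, isOpen_univ, dense_univ, fun _ _ _ => h⟩
    · exact ⟨_, isOpen_interior, h, fun u hu hu' => absurd hu' (interior_subset hu)⟩
  choose D' hDo' hDd' hD' using h3
  have hd1 : Dense {q | rk q₀ ≤ rk q} := dense_finrank_range_le (homCommutator src tgt R) q₀
  have ho1 : IsOpen {q | rk q₀ ≤ rk q} := isOpen_le_finrank_range (homCommutator src tgt R) _
  have hd2 := dense_iInter_of_finite hDo hDd
  have ho2 := isOpen_iInter_of_finite hDo
  have hd3 := dense_iInter_of_finite hDo' hDd'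
  have ho3 := isOpen_iInter_of_finite hDo'
  have hd4 := (hd3.prod hd2).inter_of_isOpen_left hd1 (ho3.prod ho2)
  obtain ⟨⟨u, w⟩, ⟨hu, hw⟩, hq⟩ := hd4.nonempty
  rw [Set.mem_iInter] at hu hw
  exact ⟨u, w, fun q => (hq₀ q).trans hq, fun L => hD L w (hw L), fun L => hD' L u (hu L)⟩

end Generic

section Factor

theorem exists_mul_eq_of_ker_le {m m' n : Type} [Fintype m] [Fintype m'] [Fintype n]
    {φ : Matrix m n ℂ} {ψ : Matrix m' n ℂ}
    (h : LinearMap.ker φ.mulVecLin ≤ LinearMap.ker ψ.mulVecLin) :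
    ∃ χ : Matrix m' m ℂ, χ * φ = ψ := by
  classical
  obtain ⟨s, hs⟩ := LinearMap.exists_rightInverse_of_surjective φ.mulVecLin.rangeRestrict
    φ.mulVecLin.range_rangeRestrict
  obtain ⟨π, hπ⟩ := LinearMap.exists_leftInverse_of_injective
    (LinearMap.range φ.mulVecLin).subtype (Submodule.ker_subtype _)
  refine ⟨LinearMap.toMatrix' (ψ.mulVecLin ∘ₗ s ∘ₗ π), ?_⟩
  refine Matrix.toLin'.injective (LinearMap.ext fun v => ?_)
  rw [Matrix.toLin'_mul, Matrix.toLin'_toMatrix']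
  have h1 : π (φ *ᵥ v) = φ.mulVecLin.rangeRestrict v :=
    LinearMap.congr_fun hπ (φ.mulVecLin.rangeRestrict v)
  have h2 : s (φ.mulVecLin.rangeRestrict v) - v ∈ LinearMap.ker φ.mulVecLin := by
    rw [LinearMap.mem_ker, map_sub, sub_eq_zero]
    exact congrArg Subtype.val (LinearMap.congr_fun hs (φ.mulVecLin.rangeRestrict v))
  have h3 := h h2
  rw [LinearMap.mem_ker, map_sub, sub_eq_zero] at h3
  simp only [LinearMap.comp_apply, Matrix.toLin'_apply, h1]
  exact h3

end Factor

section Induction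

variable {V A : Type} {src tgt : A → V}
variable {W : V → Type} [∀ x, Fintype (W x)]

theorem finrank_homSpace [Fintype V] {J : V → Type} [∀ x, Fintype (J x)]
    (R : ∀ x, W x → J x → Prop) :
    Module.finrank ℂ (homSpace R) = ∑ x, ∑ j, Nat.card {w // R x w j} := by
  classical
  let e : homSpace R ≃ₗ[ℂ]
      coordSubspace fun s : Σ x, W x × J x => R s.1 s.2.1 s.2.2 :=
    { toFun := fun φ => ⟨fun s => φ.1 s.1 s.2.1 s.2.2, fun s hs => φ.2 _ _ _ hs⟩
      map_add' := fun _ _ => rfl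
      map_smul' := fun _ _ => rfl
      invFun := fun v => ⟨fun x => .of fun w j => v.1 ⟨x, w, j⟩, fun x w j h => v.2 ⟨x, w, j⟩ h⟩
      left_inv := fun _ => rfl
      right_inv := fun _ => rfl }
  rw [e.finrank_eq, finrank_coordSubspace, Finset.card_filter, Fintype.sum_sigma]
  refine Finset.sum_congr rfl fun x _ => ?_
  rw [Fintype.sum_prod_type_right]
  refine Finset.sum_congr rfl fun j _ => ?_
  rw [Nat.card_eq_fintype_card, Fintype.card_subtype, Finset.card_filter]

variable {J : V → Type} [∀ x, LinearOrder (J x)] [∀ x, Fintype (J x)]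

theorem surjective_homCommutator_of_restrict [Finite V] [Finite A] {R : ∀ x, W x → J x → Prop}
    {u : ∀ a, Matrix (J (tgt a)) (J (src a)) ℂ} {w : ∀ a, Matrix (W (tgt a)) (W (src a)) ℂ}
    (hmax : ∀ q, Module.finrank ℂ (LinearMap.range (homCommutator src tgt R q)) ≤
        Module.finrank ℂ (LinearMap.range (homCommutator src tgt R (u, w))))
    {φ : homSpace R} (hφ : homCommutator src tgt R (u, w) φ = 0)
    {L : ∀ x, Finset (J x)} {ι : ∀ x, Matrix (J x) (L x) ℂ} (hι : ∀ x, rowProj (L x) * ι x = 1)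
    (hker : ∀ x, LinearMap.ker (φ.1 x).mulVecLin ≤ LinearMap.range (ι x).mulVecLin)
    {b : ∀ a, Matrix (L (tgt a)) (L (src a)) ℂ} (hb : ∀ a, u a * ι (src a) = ι (tgt a) * b a)
    (hsurj : Function.Surjective (homCommutator src tgt (J := fun x => L x)
      (fun x i l => R x i l) (b, w))) :
    Function.Surjective (homCommutator src tgt R (u, w)) := by
  intro ψ
  obtain ⟨φ', hφ'⟩ := hsurj fun a => ψ a * ι (src a)
  let φ₁ : homSpace R := ⟨fun x => φ'.1 x * rowProj (L x), by
    intro x i j hij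
    change (φ'.1 x * rowProj (L x) : Matrix _ _ ℂ) i j = 0
    rw [Matrix.mul_apply]
    refine Finset.sum_eq_zero fun l _ => ?_
    by_cases h : (l : J x) = j
    · rw [φ'.2 x i l (fun hR => hij (h ▸ hR)), zero_mul]
    · have : rowProj (L x) l j = 0 := by simp [rowProj, h]
      rw [this, mul_zero]⟩
  let ψ' := ψ - homCommutator src tgt R (u, w) φ₁
  have h1 : ∀ a, ψ' a * ι (src a) = 0 := by
    intro a
    have h2 := congrFun hφ' a
    rw [homCommutator_apply] at h2
    have h3 : homCommutator src tgt R (u, w) φ₁ a * ι (src a) = ψ a * ι (src a) := by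
      rw [homCommutator_apply, Matrix.sub_mul, Matrix.mul_assoc, Matrix.mul_assoc _ (u a), hb,
        ← h2]
      simp only [φ₁, Matrix.mul_assoc, hι, Matrix.mul_one]
      rw [← Matrix.mul_assoc (rowProj _), hι, Matrix.one_mul]
    simp only [ψ', Pi.sub_apply, Matrix.sub_mul, h3, sub_self]
  have h4 : ∀ a, ∃ χ : Matrix (W (tgt a)) (W (src a)) ℂ, χ * φ.1 (src a) = ψ' a := by
    intro a
    refine exists_mul_eq_of_ker_le ((hker _).trans ?_)
    rintro _ ⟨c, rfl⟩
    rw [LinearMap.mem_ker, Matrix.mulVecLin_apply, Matrix.mulVecLin_apply, Matrix.mulVec_mulVec,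
      h1, Matrix.zero_mulVec]
  choose χ hχ using h4
  obtain ⟨φ₂, hφ₂⟩ := apply_mem_range_of_finrank_max (homCommutator src tgt R) hmax hφ (0, χ)
  refine ⟨φ₁ + φ₂, ?_⟩
  rw [map_add, hφ₂]
  funext a
  simp [homCommutator_apply, hχ, ψ']

/-- The number of equations minus the number of unknowns of the commutator map, restricted to
the positions `μ`. -/
noncomputable def homExcess [Fintype V] [Fintype A] (src tgt : A → V) (R : ∀ x, W x → J x → Prop)
    {H : V → Type} [∀ x, Fintype (H x)] (μ : ∀ x, H x → J x) : ℤ :=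
  ∑ a, (Fintype.card (H (src a)) : ℤ) * (Fintype.card (W (tgt a)) : ℤ) -
    ∑ x, ∑ h, (Nat.card {w // R x w (μ x h)} : ℤ)

/-- If no commutator map is surjective, there is an intersecting family of positions accounting
for it numerically. -/
theorem exists_isIntersecting_homExcess_pos [Fintype V] [Fintype A]
    (R : ∀ x, W x → J x → Prop)
    (h : ∀ p, ¬ Function.Surjective (homCommutator src tgt R p)) :
    ∃ (H : V → Type) (_ : ∀ x, LinearOrder (H x)) (_ : ∀ x, Fintype (H x))
      (μ : ∀ x, H x → J x), (∀ x, StrictMono (μ x)) ∧ IsIntersecting src tgt μ ∧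
        0 < homExcess src tgt R μ := by
  induction hN : ∑ x, Fintype.card (J x) using Nat.strong_induction_on generalizing J with
  | _ N ih =>
  obtain ⟨u₀, w₀, hmax, hsub, hgen⟩ := exists_generic_pair (src := src) (tgt := tgt) R
  by_cases hinj : LinearMap.ker (homCommutator src tgt R (u₀, w₀)) = ⊥
  · refine ⟨J, inferInstance, inferInstance, fun x j => j, fun x => strictMono_id, ?_, ?_⟩
    · intro r
      refine ⟨r, fun x => 1, fun x => 1, ?_, ?_, ?_⟩
      · intro x i j hij
        exact Matrix.one_apply_ne hij.ne'
      · intro x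
        exact Matrix.one_mul _
      · intro a
        rw [Matrix.mul_one, Matrix.one_mul]
    · have h1 := LinearMap.finrank_range_of_inj (LinearMap.ker_eq_bot.1 hinj)
      have h2 : Module.finrank ℂ (LinearMap.range (homCommutator src tgt R (u₀, w₀))) <
          Module.finrank ℂ (∀ a, Matrix (W (tgt a)) (J (src a)) ℂ) := by
        refine Submodule.finrank_lt fun htop => ?_
        exact h _ (LinearMap.range_eq_top.1 htop)
      rw [h1, finrank_homSpace, Module.finrank_pi_fintype] at h2
      simp only [Module.finrank_matrix, Module.finrank_self, mul_one] at h2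
      rw [homExcess, sub_pos]
      simp only [mul_comm (Fintype.card (J _) : ℤ)]
      exact_mod_cast h2
  · obtain ⟨φ, hφ, hφ0⟩ := Submodule.exists_mem_ne_zero_of_ne_bot hinj
    rw [LinearMap.mem_ker] at hφ
    have hφa : ∀ a, w₀ a * φ.1 (src a) = φ.1 (tgt a) * u₀ a := fun a => by
      have := congrFun hφ a
      rw [homCommutator_apply] at this
      exact sub_eq_zero.1 this
    choose L ι hι hS using fun x => exists_isEchelon (LinearMap.ker (φ.1 x).mulVecLin)
    have hφι : ∀ x, φ.1 x * ι x = 0 := by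
      intro x
      refine Matrix.ext_of_mulVec_single fun l => ?_
      have h1 : ι x *ᵥ Pi.single l 1 ∈ LinearMap.ker (φ.1 x).mulVecLin := by
        rw [← hS]
        exact ⟨_, rfl⟩
      rw [← Matrix.mulVec_mulVec, Matrix.zero_mulVec]
      exact h1
    have hsubrep : IsSubrep u₀ fun x => LinearMap.range (ι x).mulVecLin := by
      intro a v hv
      simp only [hS, LinearMap.mem_ker, Matrix.mulVecLin_apply] at hv ⊢
      rw [Matrix.mulVec_mulVec, ← hφa, ← Matrix.mulVec_mulVec, hv, Matrix.mulVec_zero]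
    have hL := hgen L (embeds_of_isSubrep hι hsubrep)
    have hcard : ∑ x, Fintype.card (L x) < ∑ x, Fintype.card (J x) := by
      obtain ⟨x, hx⟩ : ∃ x, φ.1 x ≠ 0 := by
        by_contra! hall
        exact hφ0 (Subtype.ext (funext hall))
      refine Finset.sum_lt_sum (fun x _ => ?_) ⟨x, Finset.mem_univ _, ?_⟩
      · rw [Fintype.card_coe]
        exact Finset.card_le_univ _
      · rw [Fintype.card_coe, ← (hι x).finrank_range, hS, ← Module.finrank_fintype_fun_eq_card ℂ]
        refine Submodule.finrank_lt fun htop => hx ?_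
        rw [LinearMap.ker_eq_top] at htop
        refine Matrix.toLin'.injective ?_
        rw [map_zero]
        exact htop
    have hns : ∀ p, ¬ Function.Surjective (homCommutator src tgt (J := fun x => L x)
        (fun x i l => R x i l) p) := by
      intro p hp
      obtain ⟨b, hb⟩ := hsub L ⟨p, hp⟩
      let b₀ : ∀ a, Matrix (L (tgt a)) (L (src a)) ℂ :=
        fun a => rowProj (L (tgt a)) * u₀ a * ι (src a)
      let E : ∀ a, Matrix (J (tgt a)) (J (src a)) ℂ :=
        fun a => ι (tgt a) * (b a - b₀ a) * rowProj (L (src a))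
      have hE : homCommutator src tgt R (E, 0) φ = 0 := by
        funext a
        rw [homCommutator_apply]
        simp only [E, Pi.zero_apply, Matrix.zero_mul, zero_sub, neg_eq_zero]
        rw [← Matrix.mul_assoc, ← Matrix.mul_assoc, hφι, Matrix.zero_mul, Matrix.zero_mul]
      have hfin1 := finite_finrank_range_lt (homCommutator src tgt R (u₀, w₀))
        (homCommutator src tgt R (E, 0)) 0
      have hfin2 := finite_finrank_range_lt
        (homCommutator src tgt (J := fun x => L x) (fun x i l => R x i l) (b₀, w₀))
        (homCommutator src tgt (J := fun x => L x) (fun x i l => R x i l) (b - b₀, 0)) 1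
      obtain ⟨t, ht⟩ := (hfin1.union hfin2).infinite_compl.nonempty
      rw [Set.mem_compl_iff, Set.mem_union, not_or] at ht
      have ht1 := not_lt.1 (Set.notMem_ofPred_iff.1 ht.1)
      have ht2 := not_lt.1 (Set.notMem_ofPred_iff.1 ht.2)
      have h1 : ((u₀, w₀) : _ × _) + t • (E, 0) = (u₀ + t • E, w₀) := by simp
      have h2 : ((b₀, w₀) : _ × _) + (b - b₀, 0) = (b, w₀) := by simp
      have h3 : ((b₀, w₀) : _ × _) + t • (b - b₀, 0) = (b₀ + t • (b - b₀), w₀) := by simp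
      rw [zero_smul, add_zero, ← map_smul, ← map_add, h1] at ht1
      rw [one_smul, ← map_add, h2, ← map_smul, ← map_add, h3] at ht2
      rw [LinearMap.range_eq_top.2 hb, finrank_top] at ht2
      refine h _ (surjective_homCommutator_of_restrict (u := u₀ + t • E) (w := w₀) (φ := φ)
        (ι := ι) (b := b₀ + t • (b - b₀)) (fun q => (hmax q).trans ht1) ?_
        (fun x => (hι x).rowProj_mul_self) (fun x => (hS x).ge) ?_ ?_)
      · rw [← h1, map_add, map_smul, LinearMap.add_apply, LinearMap.smul_apply, hφ, hE, smul_zero,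
          add_zero]
      · intro a
        have h1 := mul_eq_of_isSubrep hι hsubrep a
        simp only [Pi.add_apply, Pi.smul_apply, Matrix.add_mul, Matrix.mul_add, Matrix.smul_mul,
          Matrix.mul_smul, E, b₀, h1, Pi.sub_apply]
        rw [Matrix.mul_assoc _ (rowProj _), (hι _).rowProj_mul_self, Matrix.mul_one]
      · exact LinearMap.range_eq_top.1
          (Submodule.eq_top_of_finrank_eq (le_antisymm (Submodule.finrank_le _) ht2))
    obtain ⟨H, _, _, μ, hμ, hμI, hpos⟩ := ih _ (hN ▸ hcard) (J := fun x => L x)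
      (fun x i l => R x i l) hns rfl
    exact ⟨H, inferInstance, inferInstance, fun x k => (μ x k : J x),
      fun x => (Subtype.strictMono_coe _).comp (hμ x),
      hL.comp hμI fun x => (Subtype.strictMono_coe _).monotone, hpos⟩

end Induction

section Double

theorem finrank_map_sup_map_add {X Y Z : Type} [AddCommGroup X] [Module ℂ X] [AddCommGroup Y]
    [Module ℂ Y] [AddCommGroup Z] [Module ℂ Z] [FiniteDimensional ℂ X] {f : X →ₗ[ℂ] Z}
    {c : Y →ₗ[ℂ] Z} (hinj : ∀ x y, f x + c y = 0 → x = 0 ∧ y = 0) (φ : X →ₗ[ℂ] Y)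
    (S : Submodule ℂ X) :
    Module.finrank ℂ (S.map f ⊔ S.map (c ∘ₗ φ) : Submodule ℂ Z) +
      Module.finrank ℂ ((LinearMap.ker φ ⊓ S).map f) = 2 * Module.finrank ℂ S := by
  have hf : Function.Injective f := by
    rw [← LinearMap.ker_eq_bot, LinearMap.ker_eq_bot']
    intro x hx
    exact (hinj x 0 (by simp [hx])).1
  have hc : Function.Injective c := by
    rw [← LinearMap.ker_eq_bot, LinearMap.ker_eq_bot']
    intro y hy
    exact (hinj 0 y (by simp [hy])).2
  have h1 := Submodule.finrank_sup_add_finrank_inf_eq (S.map f) (S.map (c ∘ₗ φ))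
  have h2 : S.map f ⊓ S.map (c ∘ₗ φ) = ⊥ := by
    rw [eq_bot_iff]
    rintro _ ⟨⟨x, _, rfl⟩, ⟨y, _, hy⟩⟩
    have := (hinj x (- φ y) (by rw [map_neg, ← hy]; simp)).1
    rw [this, map_zero]
    exact zero_mem _
  rw [h2, finrank_bot, add_zero] at h1
  have h3 := LinearMap.finrank_range_add_finrank_ker (φ.domRestrict S)
  have h4 : Module.finrank ℂ (LinearMap.ker (φ.domRestrict S)) =
      Module.finrank ℂ (LinearMap.ker φ ⊓ S : Submodule ℂ X) := by
    rw [LinearMap.ker_domRestrict, inf_comm, ← Submodule.map_comap_subtype,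
      ← (Submodule.equivMapOfInjective _ S.subtype_injective _).finrank_eq]
  rw [LinearMap.range_domRestrict, h4] at h3
  rw [h1, Submodule.map_comp, ← (Submodule.equivMapOfInjective _ hf _).finrank_eq,
    ← (Submodule.equivMapOfInjective _ hc _).finrank_eq,
    ← (Submodule.equivMapOfInjective _ hf _).finrank_eq]
  omega

end Double

section Pair

/-- The projection onto the coordinates outside `L` along the range of an echelon matrix. -/
def quotProj {J : Type} [DecidableEq J] [Fintype J] {L : Finset J} (ι : Matrix J L ℂ) :
    Matrix {j // j ∉ L} J ℂ := .of fun i j => (1 - ι * rowProj L : Matrix J J ℂ) i j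

/-- The inclusion of the coordinates outside `L`. -/
def complIncl {J : Type} [DecidableEq J] (L : Finset J) : Matrix J {j // j ∉ L} ℂ :=
  fun j i => if j = (i : J) then 1 else 0

variable {J : Type} [LinearOrder J] [Fintype J] {L : Finset J} {ι : Matrix J L ℂ}

theorem complIncl_mul {m : Type} (M : Matrix {j // j ∉ L} m ℂ) (j : J) (k : m) :
    (complIncl L * M : Matrix _ _ ℂ) j k = if h : j ∈ L then 0 else M ⟨j, h⟩ k := by
  rw [Matrix.mul_apply]
  split_ifs with h
  · refine Finset.sum_eq_zero fun i _ => ?_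
    have : j ≠ i := fun h' => i.2 (h' ▸ h)
    simp [complIncl, this]
  · rw [Finset.sum_eq_single ⟨j, h⟩]
    · simp [complIncl]
    · intro i _ hi
      have : j ≠ i := fun h' => hi (Subtype.ext h'.symm)
      simp [complIncl, this]
    · simp

theorem IsEchelon.complIncl_mul_quotProj (h : IsEchelon L ι) :
    complIncl L * quotProj ι + ι * rowProj L = 1 := by
  rw [← eq_sub_iff_add_eq]
  ext j k
  rw [complIncl_mul]
  split_ifs with hj
  · have h1 : rowProj L * (1 - ι * rowProj L) = 0 := by
      rw [Matrix.mul_sub, Matrix.mul_one, ← Matrix.mul_assoc, h.rowProj_mul_self, Matrix.one_mul,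
        sub_self]
    have h2 := congrFun (congrFun h1 ⟨j, hj⟩) k
    rw [rowProj_mul] at h2
    exact h2.symm
  · rfl

theorem rowProj_mul_complIncl : rowProj L * complIncl L = 0 := by
  ext l i
  have : (l : J) ≠ i := fun h => i.2 (h ▸ l.2)
  simp [rowProj_mul, complIncl, this]

theorem IsEchelon.mulVec_add_complIncl_mulVec (h : IsEchelon L ι) {x : L → ℂ}
    {y : {j // j ∉ L} → ℂ} (hxy : ι *ᵥ x + complIncl L *ᵥ y = 0) : x = 0 ∧ y = 0 := by
  have hx : x = 0 := by
    have h1 := congrArg (rowProj L *ᵥ ·) hxy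
    simpa [Matrix.mulVec_add, Matrix.mulVec_mulVec, h.rowProj_mul_self,
      rowProj_mul_complIncl] using h1
  refine ⟨hx, ?_⟩
  rw [hx, Matrix.mulVec_zero, zero_add] at hxy
  funext i
  have h1 := congrFun hxy i
  simpa [Matrix.mulVec, dotProduct, complIncl, ← Subtype.ext_iff] using h1

theorem IsEchelon.finrank_sup_add_finrank_map_ker (h : IsEchelon L ι)
    (φ : Matrix {j // j ∉ L} L ℂ) :
    Module.finrank ℂ (LinearMap.range ι.mulVecLin ⊔ LinearMap.range (complIncl L * φ).mulVecLin :
        Submodule ℂ (J → ℂ)) +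
      Module.finrank ℂ ((LinearMap.ker φ.mulVecLin).map ι.mulVecLin) = 2 * L.card := by
  have h1 := finrank_map_sup_map_add (f := ι.mulVecLin) (c := (complIncl L).mulVecLin)
    (fun x y hxy => h.mulVec_add_complIncl_mulVec hxy) φ.mulVecLin ⊤
  rw [Submodule.map_top, Submodule.map_top, inf_top_eq, ← Matrix.mulVecLin_mul] at h1
  simpa using h1

theorem IsEchelon.card_filter_le_finrank_inf (h : IsEchelon L ι) {φ : Matrix {j // j ∉ L} L ℂ}
    (hφ : ∀ (i : {j // j ∉ L}) (l : L), ¬ (i : J) < l → φ i l = 0) (D : J → Prop) [DecidablePred D]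
    (hD : ∀ i j, i ≤ j → D j → D i) :
    2 * (L.filter D).card ≤
      Module.finrank ℂ ((LinearMap.range ι.mulVecLin ⊔
        LinearMap.range (complIncl L * φ).mulVecLin) ⊓
        coordSubspace D : Submodule ℂ (J → ℂ)) +
      Module.finrank ℂ ((LinearMap.ker φ.mulVecLin).map ι.mulVecLin ⊓ coordSubspace D :
        Submodule ℂ (J → ℂ)) := by
  have h1 := finrank_map_sup_map_add (f := ι.mulVecLin) (c := (complIncl L).mulVecLin)
    (fun x y hxy => h.mulVec_add_complIncl_mulVec hxy) φ.mulVecLin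
    (coordSubspace fun l : L => D l)
  have h2 : Module.finrank ℂ (coordSubspace fun l : L => D l) = (L.filter D).card := by
    rw [finrank_coordSubspace, ← Finset.card_map (Function.Embedding.subtype _)]
    congr 1
    ext l
    simp [and_comm]
  rw [h2] at h1
  have h3 : (coordSubspace fun l : L => D l).map ι.mulVecLin ≤ coordSubspace D := by
    rintro _ ⟨c, hc, rfl⟩ j hj
    rw [Matrix.mulVecLin_apply]
    refine Finset.sum_eq_zero fun l _ => ?_
    by_cases hl : D l
    · show ι j l * c l = 0
      rw [h.below j l, zero_mul]
      by_contra hlt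
      exact hj (hD _ _ (not_lt.1 hlt) hl)
    · show ι j l * c l = 0
      rw [hc l hl, mul_zero]
  have h4 : (coordSubspace fun l : L => D l).map ((complIncl L).mulVecLin ∘ₗ φ.mulVecLin) ≤
      coordSubspace D := by
    rw [← Matrix.mulVecLin_mul]
    rintro _ ⟨c, hc, rfl⟩ j hj
    rw [Matrix.mulVecLin_apply]
    refine Finset.sum_eq_zero fun l _ => ?_
    show (complIncl L * φ : Matrix _ _ ℂ) j l * c l = 0
    by_cases hl : D l
    · rw [complIncl_mul]
      split_ifs with hjL
      · rw [zero_mul]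
      · rw [hφ, zero_mul]
        exact fun hlt => hj (hD _ _ hlt.le hl)
    · rw [hc l hl, mul_zero]
  rw [← h1]
  refine add_le_add (Submodule.finrank_mono ?_) (Submodule.finrank_mono ?_)
  · refine le_inf (sup_le_sup ?_ ?_) (sup_le h3 h4)
    · exact LinearMap.map_le_range
    · rw [Matrix.mulVecLin_mul]
      exact LinearMap.map_le_range
  · exact le_inf (Submodule.map_mono inf_le_left) ((Submodule.map_mono inf_le_right).trans h3)

end Pair

section PairSubrep

variable {V A : Type} {src tgt : A → V} {J : V → Type} [∀ x, LinearOrder (J x)]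
  [∀ x, Fintype (J x)] {u : ∀ a, Matrix (J (tgt a)) (J (src a)) ℂ} {L : ∀ x, Finset (J x)}
  {ι : ∀ x, Matrix (J x) (L x) ℂ} {φ : ∀ x, Matrix {j // j ∉ L x} (L x) ℂ}

theorem isSubrep_map_ker (hι : ∀ x, IsEchelon (L x) (ι x))
    (hsub : IsSubrep u fun x => LinearMap.range (ι x).mulVecLin)
    (hφ : ∀ a, quotProj (ι (tgt a)) * u a * complIncl (L (src a)) * φ (src a) =
      φ (tgt a) * (rowProj (L (tgt a)) * u a * ι (src a))) :
    IsSubrep u fun x => (LinearMap.ker (φ x).mulVecLin).map (ι x).mulVecLin := by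
  rintro a _ ⟨c, hc, rfl⟩
  refine ⟨(rowProj (L (tgt a)) * u a * ι (src a)) *ᵥ c, ?_, ?_⟩
  · simp only [SetLike.mem_coe, LinearMap.mem_ker, Matrix.mulVecLin_apply] at hc ⊢
    rw [Matrix.mulVec_mulVec, ← hφ, ← Matrix.mulVec_mulVec, hc, Matrix.mulVec_zero]
  · simp only [Matrix.mulVecLin_apply, Matrix.mulVec_mulVec]
    rw [mul_eq_of_isSubrep hι hsub]

theorem isSubrep_sup (hι : ∀ x, IsEchelon (L x) (ι x))
    (hsub : IsSubrep u fun x => LinearMap.range (ι x).mulVecLin)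
    (hφ : ∀ a, quotProj (ι (tgt a)) * u a * complIncl (L (src a)) * φ (src a) =
      φ (tgt a) * (rowProj (L (tgt a)) * u a * ι (src a))) :
    IsSubrep u fun x => LinearMap.range (ι x).mulVecLin ⊔
      LinearMap.range (complIncl (L x) * φ x).mulVecLin := by
  intro a v hv
  obtain ⟨v₁, h₁, _, ⟨c, rfl⟩, rfl⟩ := Submodule.mem_sup.1 hv
  rw [Matrix.mulVec_add]
  refine add_mem (Submodule.mem_sup_left (hsub a v₁ h₁)) ?_
  have h2 : u a * (complIncl (L (src a)) * φ (src a)) =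
      ι (tgt a) * (rowProj (L (tgt a)) * u a * complIncl (L (src a)) * φ (src a)) +
      complIncl (L (tgt a)) * φ (tgt a) * (rowProj (L (tgt a)) * u a * ι (src a)) := by
    have h3 := congrArg (· * (u a * (complIncl (L (src a)) * φ (src a))))
      (hι (tgt a)).complIncl_mul_quotProj
    simp only [Matrix.add_mul, Matrix.one_mul] at h3
    rw [Matrix.mul_assoc (complIncl _) (φ _), ← hφ, ← h3, add_comm]
    simp only [Matrix.mul_assoc]
  rw [Matrix.mulVecLin_apply, Matrix.mulVec_mulVec, h2, Matrix.add_mulVec]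
  refine add_mem (Submodule.mem_sup_left ?_) (Submodule.mem_sup_right ?_)
  · rw [← Matrix.mulVec_mulVec]
    exact ⟨_, rfl⟩
  · rw [← Matrix.mulVec_mulVec]
    exact ⟨_, rfl⟩

theorem eq_zero_of_card_le_finrank_map_ker [Fintype V] (hι : ∀ x, IsEchelon (L x) (ι x))
    (h : ∑ x, (L x).card ≤
      ∑ x, Module.finrank ℂ ((LinearMap.ker (φ x).mulVecLin).map (ι x).mulVecLin)) : φ = 0 := by
  have h1 : ∀ x, Module.finrank ℂ ((LinearMap.ker (φ x).mulVecLin).map (ι x).mulVecLin) =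
      Module.finrank ℂ (LinearMap.ker (φ x).mulVecLin) := fun x =>
    (Submodule.equivMapOfInjective _ (hι x).injective _).finrank_eq.symm
  have h2 : ∀ x, Module.finrank ℂ (LinearMap.ker (φ x).mulVecLin) ≤ (L x).card := by
    intro x
    simpa using Submodule.finrank_le (LinearMap.ker (φ x).mulVecLin)
  simp only [h1] at h
  funext x
  have h3 := (Finset.sum_eq_sum_iff_of_le fun x _ => h2 x).1
    (le_antisymm (Finset.sum_le_sum fun x _ => h2 x) h) x (Finset.mem_univ x)
  have h4 : LinearMap.ker (φ x).mulVecLin = ⊤ := Submodule.eq_top_of_finrank_eq (by simpa using h3)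
  rw [LinearMap.ker_eq_top] at h4
  refine Matrix.toLin'.injective ?_
  rw [Pi.zero_apply, map_zero]
  exact h4

end PairSubrep

section Destabilize

variable {V A : Type} [Fintype V] [Fintype A] {src tgt : A → V}
variable {W : V → Type} [∀ x, Fintype (W x)]
variable {J : V → Type}

/-- The excess `homExcess` of a family of subspaces, in terms of the dimensions of its
intersections with coordinate subspaces. -/
noncomputable def subspaceExcess (src tgt : A → V) (R : ∀ x, W x → J x → Prop)
    (S : ∀ x, Submodule ℂ (J x → ℂ)) : ℤ :=
  ∑ a, (Module.finrank ℂ (S (src a)) : ℤ) * (Fintype.card (W (tgt a)) : ℤ) -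
    ∑ x, ∑ w, ((Module.finrank ℂ (S x) : ℤ) -
      (Module.finrank ℂ (S x ⊓ coordSubspace (fun j => ¬ R x w j) : Submodule ℂ (J x → ℂ)) : ℤ))

theorem two_mul_subspaceExcess_le {R : ∀ x, W x → J x → Prop}
    {S T T' : ∀ x, Submodule ℂ (J x → ℂ)}
    (h1 : ∀ x, Module.finrank ℂ (T x) + Module.finrank ℂ (T' x) = 2 * Module.finrank ℂ (S x))
    (h2 : ∀ x w, 2 * Module.finrank ℂ
        (S x ⊓ coordSubspace (fun j => ¬ R x w j) : Submodule ℂ (J x → ℂ)) ≤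
      Module.finrank ℂ (T x ⊓ coordSubspace (fun j => ¬ R x w j) : Submodule ℂ (J x → ℂ)) +
      Module.finrank ℂ (T' x ⊓ coordSubspace (fun j => ¬ R x w j) : Submodule ℂ (J x → ℂ))) :
    2 * subspaceExcess src tgt R S ≤ subspaceExcess src tgt R T + subspaceExcess src tgt R T' := by
  have h3 : ∑ a, (Module.finrank ℂ (T (src a)) : ℤ) * (Fintype.card (W (tgt a)) : ℤ) +
      ∑ a, (Module.finrank ℂ (T' (src a)) : ℤ) * (Fintype.card (W (tgt a)) : ℤ) =
      2 * ∑ a, (Module.finrank ℂ (S (src a)) : ℤ) * (Fintype.card (W (tgt a)) : ℤ) := by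
    rw [← Finset.sum_add_distrib, Finset.mul_sum]
    refine Finset.sum_congr rfl fun a _ => ?_
    rw [← add_mul, ← mul_assoc]
    congr 1
    exact_mod_cast h1 (src a)
  have h4 : ∑ x, ∑ w, ((Module.finrank ℂ (T x) : ℤ) -
      (Module.finrank ℂ (T x ⊓ coordSubspace (fun j => ¬ R x w j) :
        Submodule ℂ (J x → ℂ)) : ℤ)) + ∑ x, ∑ w, ((Module.finrank ℂ (T' x) : ℤ) -
      (Module.finrank ℂ (T' x ⊓ coordSubspace (fun j => ¬ R x w j) :
        Submodule ℂ (J x → ℂ)) : ℤ)) ≤ 2 * ∑ x, ∑ w, ((Module.finrank ℂ (S x) : ℤ) -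
      (Module.finrank ℂ (S x ⊓ coordSubspace (fun j => ¬ R x w j) :
        Submodule ℂ (J x → ℂ)) : ℤ)) := by
    rw [← Finset.sum_add_distrib, Finset.mul_sum]
    refine Finset.sum_le_sum fun x _ => ?_
    rw [← Finset.sum_add_distrib, Finset.mul_sum]
    refine Finset.sum_le_sum fun w _ => ?_
    have := h1 x
    have := h2 x w
    omega
  simp only [subspaceExcess]
  linarith

variable [∀ x, LinearOrder (J x)] [∀ x, Fintype (J x)]

theorem subspaceExcess_range {R : ∀ x, W x → J x → Prop}
    (hR : ∀ x w i j, i ≤ j → R x w i → R x w j) {L : ∀ x, Finset (J x)}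
    {ι : ∀ x, Matrix (J x) (L x) ℂ} (hι : ∀ x, IsEchelon (L x) (ι x)) :
    subspaceExcess src tgt R (fun x => LinearMap.range (ι x).mulVecLin) =
      homExcess src tgt R fun x (l : L x) => (l : J x) := by
  classical
  rw [subspaceExcess, homExcess]
  congr 1
  · simp only [(hι _).finrank_range, Fintype.card_coe]
  · refine Finset.sum_congr rfl fun x _ => ?_
    have h1 : ∀ w, ((Module.finrank ℂ (LinearMap.range (ι x).mulVecLin) : ℤ) -
        (Module.finrank ℂ (LinearMap.range (ι x).mulVecLin ⊓ coordSubspace (fun j => ¬ R x w j) :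
          Submodule ℂ (J x → ℂ)) : ℤ)) = ∑ l : L x, if R x w l then 1 else 0 := by
      intro w
      rw [(hι x).finrank_range, (hι x).finrank_inf (fun j => ¬ R x w j)
        fun i j hij hj hi => hj (hR x w i j hij hi), Finset.sum_coe_sort (L x)
        (fun j => if R x w j then (1 : ℤ) else 0), Finset.sum_boole]
      have := Finset.card_filter_add_card_filter_not (s := L x) (fun j => R x w j)
      omega
    simp only [h1]
    rw [Finset.sum_comm]
    refine Finset.sum_congr rfl fun l _ => ?_
    rw [Finset.sum_boole, Nat.card_eq_fintype_card, Fintype.card_subtype]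

/-- The quantity maximized by the destabilizing subrepresentation: the excess first, then the
codimension. -/
noncomputable def weightedExcess (src tgt : A → V) (R : ∀ x, W x → J x → Prop)
    (S : ∀ x, Submodule ℂ (J x → ℂ)) : ℤ :=
  (∑ x, (Fintype.card (J x) : ℤ) + 1) * subspaceExcess src tgt R S -
    ∑ x, (Module.finrank ℂ (S x) : ℤ)

theorem exists_forall_weightedExcess_le {R : ∀ x, W x → J x → Prop}
    (hR : ∀ x w i j, i ≤ j → R x w i → R x w j) (u : ∀ a, Matrix (J (tgt a)) (J (src a)) ℂ) :
    ∃ (L : ∀ x, Finset (J x)) (ι : ∀ x, Matrix (J x) (L x) ℂ), (∀ x, IsEchelon (L x) (ι x)) ∧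
      (IsSubrep u fun x => LinearMap.range (ι x).mulVecLin) ∧
      ∀ S, IsSubrep u S →
        weightedExcess src tgt R S ≤
          weightedExcess src tgt R fun x => LinearMap.range (ι x).mulVecLin := by
  classical
  let F : (∀ x, Finset (J x)) → ℤ := fun L =>
    (∑ x, (Fintype.card (J x) : ℤ) + 1) * homExcess src tgt R (fun x (l : L x) => (l : J x)) -
      ∑ x, ((L x).card : ℤ)
  have hF : ∀ (L : ∀ x, Finset (J x)) (ι : ∀ x, Matrix (J x) (L x) ℂ),
      (∀ x, IsEchelon (L x) (ι x)) →
      weightedExcess src tgt R (fun x => LinearMap.range (ι x).mulVecLin) = F L := by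
    intro L ι hι
    simp only [weightedExcess, subspaceExcess_range hR hι, (hι _).finrank_range, F]
  let 𝒮 : Set (∀ x, Finset (J x)) := {L | ∃ ι : ∀ x, Matrix (J x) (L x) ℂ,
    (∀ x, IsEchelon (L x) (ι x)) ∧ IsSubrep u fun x => LinearMap.range (ι x).mulVecLin}
  have hmem : ∀ S, IsSubrep u S → ∃ L ∈ 𝒮, weightedExcess src tgt R S = F L := by
    intro S hS
    choose L ι hι hr using fun x => exists_isEchelon (S x)
    have hS' : S = fun x => LinearMap.range (ι x).mulVecLin := (funext hr).symm
    rw [hS'] at hS ⊢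
    exact ⟨L, ⟨ι, hι, hS⟩, hF L ι hι⟩
  obtain ⟨L₀, hL₀, -⟩ := hmem (fun _ => ⊤) fun _ _ _ => Submodule.mem_top
  obtain ⟨L, ⟨ι, hι, hL⟩, hmax⟩ := Set.exists_max_image 𝒮 F 𝒮.toFinite ⟨L₀, hL₀⟩
  refine ⟨L, ι, hι, hL, fun S hS => ?_⟩
  obtain ⟨L', hL', h⟩ := hmem S hS
  rw [h, hF L ι hι]
  exact hmax L' hL'

theorem card_filter_lt_sub_card_filter_lt {J : Type} [LinearOrder J] [Fintype J] (L : Finset J)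
    (l : L) : ((Finset.univ.filter (· < (l : J))).card : ℤ) -
      ((Finset.univ.filter (· < l)).card : ℤ) = Nat.card {w : {j // j ∉ L} // (w : J) < l} := by
  classical
  have h1 : (Finset.univ.filter (· < l)).card =
      (Finset.univ.filter fun j => j < (l : J) ∧ j ∈ L).card := by
    rw [← Finset.card_map (Function.Embedding.subtype _)]
    congr 1
    ext i
    simp [← Subtype.coe_lt_coe, and_comm]
  have h2 : Nat.card {w : {j // j ∉ L} // (w : J) < l} =
      (Finset.univ.filter fun j => j < (l : J) ∧ j ∉ L).card := by
    rw [Nat.card_eq_fintype_card, ← Fintype.card_subtype]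
    exact Fintype.card_congr
      { toFun := fun w => ⟨w.1.1, w.2, w.1.2⟩
        invFun := fun w => ⟨⟨w.1, w.2.2⟩, w.2.1⟩
        left_inv := fun _ => rfl
        right_inv := fun _ => rfl }
  have h3 := Finset.card_filter_add_card_filter_not (s := Finset.univ.filter (· < (l : J))) (· ∈ L)
  simp only [Finset.filter_filter] at h3
  omega

theorem edim_val (L : ∀ x, Finset (J x)) :
    edim src tgt (fun x (l : L x) => (l : J x)) =
      (∑ x, ∑ l : L x, (Nat.card {w : {j // j ∉ L x} // (w : J x) < l} : ℤ)) -
        ∑ a, ((L (src a)).card : ℤ) * (Fintype.card {j // j ∉ L (tgt a)} : ℤ) := by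
  simp only [edim, card_filter_lt_sub_card_filter_lt, Fintype.card_coe]
  congr 1
  refine Finset.sum_congr rfl fun a _ => ?_
  have h1 : Fintype.card {j // j ∉ L (tgt a)} + (L (tgt a)).card = Fintype.card (J (tgt a)) := by
    rw [Fintype.card_subtype_compl, Fintype.card_coe]
    exact Nat.sub_add_cancel (Finset.card_le_univ _)
  rw [← h1]
  push_cast
  ring

theorem exists_finset_isIntersecting {R : ∀ x, W x → J x → Prop}
    (hR : ∀ x w i j, i ≤ j → R x w i → R x w j)
    {H : V → Type} [∀ x, LinearOrder (H x)] [∀ x, Fintype (H x)] {μ : ∀ x, H x → J x}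
    (hμ : ∀ x, StrictMono (μ x)) (hμI : IsIntersecting src tgt μ)
    (hpos : 0 < homExcess src tgt R μ) :
    ∃ M : ∀ x, Finset (J x), IsIntersecting src tgt (fun x (m : M x) => (m : J x)) ∧
      0 < homExcess src tgt R (fun x (m : M x) => (m : J x)) ∧
      edim src tgt (fun x (m : M x) => (m : J x)) ≤ 0 := by
  classical
  obtain ⟨u, w, -, -, hgen⟩ := exists_generic_pair (src := src) (tgt := tgt) R
  obtain ⟨L, ι, hι, hL, hmax⟩ := exists_forall_weightedExcess_le (src := src) (tgt := tgt) hR u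
  have hN : (∑ x, ((L x).card : ℤ)) ≤ ∑ x, (Fintype.card (J x) : ℤ) :=
    Finset.sum_le_sum fun x _ => by exact_mod_cast Finset.card_le_univ _
  refine ⟨L, hgen L (embeds_of_isSubrep hι hL), ?_, ?_⟩
  · obtain ⟨L₀, ι₀, hι₀, hL₀, e, he⟩ := (hμI u).exists_isEchelon fun x => (hμ x).monotone
    have h1 := hmax _ hL₀
    have h2 : homExcess src tgt R μ ≤ homExcess src tgt R (fun x (l : L₀ x) => (l : J x)) := by
      have hc : ∀ x, Fintype.card (H x) = Fintype.card (L₀ x) :=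
        fun x => Fintype.card_congr (e x).toEquiv
      simp only [homExcess, hc]
      refine sub_le_sub_left (Finset.sum_le_sum fun x _ => ?_) _
      rw [← Equiv.sum_comp (e x).toEquiv]
      refine Finset.sum_le_sum fun h _ => ?_
      rw [Nat.card_eq_fintype_card, Nat.card_eq_fintype_card]
      exact_mod_cast Fintype.card_subtype_mono _ _ fun w hw => hR x w _ _ (he x h) hw
    have hN₀ : (∑ x, ((L₀ x).card : ℤ)) ≤ ∑ x, (Fintype.card (J x) : ℤ) :=
      Finset.sum_le_sum fun x _ => by exact_mod_cast Finset.card_le_univ _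
    have h3 : (0 : ℤ) ≤ ∑ x, ((L x).card : ℤ) := Finset.sum_nonneg fun _ _ => by positivity
    simp only [weightedExcess, subspaceExcess_range hR hι, subspaceExcess_range hR hι₀,
      (hι _).finrank_range, (hι₀ _).finrank_range] at h1
    by_contra! h4
    nlinarith
  · let b : ∀ a, Matrix (L (tgt a)) (L (src a)) ℂ :=
      fun a => rowProj (L (tgt a)) * u a * ι (src a)
    let q : ∀ a, Matrix {j // j ∉ L (tgt a)} {j // j ∉ L (src a)} ℂ :=
      fun a => quotProj (ι (tgt a)) * u a * complIncl (L (src a))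
    let T := homCommutator src tgt (J := fun x => L x) (W := fun x => {j // j ∉ L x})
      (fun x i l => (i : J x) < l) (b, q)
    have hT : Function.Injective T := by
      rw [← LinearMap.ker_eq_bot, LinearMap.ker_eq_bot']
      intro φ hφ
      have hφa : ∀ a, q a * φ.1 (src a) = φ.1 (tgt a) * b a := fun a => by
        have := congrFun hφ a
        rw [homCommutator_apply] at this
        exact sub_eq_zero.1 this
      have hT₁ := hmax _ (isSubrep_sup hι hL hφa)
      have hT₂ := hmax _ (isSubrep_map_ker hι hL hφa)
      have h1 := two_mul_subspaceExcess_le (src := src) (tgt := tgt) (R := R)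
        (S := fun x => LinearMap.range (ι x).mulVecLin)
        (T := fun x => LinearMap.range (ι x).mulVecLin ⊔
          LinearMap.range (complIncl (L x) * φ.1 x).mulVecLin)
        (T' := fun x => (LinearMap.ker (φ.1 x).mulVecLin).map (ι x).mulVecLin)
        (fun x => by
          rw [(hι x).finrank_range]
          exact (hι x).finrank_sup_add_finrank_map_ker (φ.1 x))
        (fun x w => by
          have hD : ∀ i j, i ≤ j → ¬ R x w j → ¬ R x w i := fun i j hij hj hi =>
            hj (hR x w i j hij hi)
          rw [(hι x).finrank_inf _ hD]
          exact (hι x).card_filter_le_finrank_inf (fun i l => φ.2 x i l) _ hD)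
      refine Subtype.ext (eq_zero_of_card_le_finrank_map_ker hι ?_)
      have h2 : ∑ x, (Module.finrank ℂ (LinearMap.range (ι x).mulVecLin ⊔
          LinearMap.range (complIncl (L x) * φ.1 x).mulVecLin : Submodule ℂ (J x → ℂ)) : ℤ) ≤
          ∑ x, (Fintype.card (J x) : ℤ) := Finset.sum_le_sum fun x _ => by
        have := Submodule.finrank_le (LinearMap.range (ι x).mulVecLin ⊔
          LinearMap.range (complIncl (L x) * φ.1 x).mulVecLin)
        rw [Module.finrank_fintype_fun_eq_card] at this
        exact_mod_cast this
      have h3 : (0 : ℤ) ≤ ∑ x, ((L x).card : ℤ) := Finset.sum_nonneg fun _ _ => by positivity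
      simp only [weightedExcess, (hι _).finrank_range] at hT₁ hT₂
      have h4 : subspaceExcess src tgt R (fun x => LinearMap.range (ι x).mulVecLin ⊔
          LinearMap.range (complIncl (L x) * φ.1 x).mulVecLin) ≤
          subspaceExcess src tgt R fun x => LinearMap.range (ι x).mulVecLin := by
        by_contra! h4
        nlinarith
      have h5 : ∑ x, ((L x).card : ℤ) ≤ ∑ x, (Module.finrank ℂ
          ((LinearMap.ker (φ.1 x).mulVecLin).map (ι x).mulVecLin) : ℤ) := by
        nlinarith
      exact_mod_cast h5
    have h1 := LinearMap.finrank_le_finrank_of_injective hT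
    rw [finrank_homSpace, Module.finrank_pi_fintype] at h1
    simp only [Module.finrank_matrix, Module.finrank_self, mul_one, Fintype.card_coe] at h1
    rw [edim_val, sub_nonpos]
    simp only [mul_comm ((L _).card : ℤ)]
    exact_mod_cast h1

end Destabilize

section Core

variable {V A : Type} [Fintype V] [Fintype A] {src tgt : A → V}
variable {I : V → Type} [∀ x, LinearOrder (I x)] [∀ x, Fintype (I x)]

theorem edim_comp_val (L : ∀ x, Finset (I x)) {H : V → Type} [∀ x, LinearOrder (H x)]
    [∀ x, Fintype (H x)] (μ : ∀ x, H x → L x) :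
    edim src tgt (fun x h => (μ x h : I x)) = edim src tgt μ -
      homExcess src tgt (W := fun x => {i // i ∉ L x}) (fun x i (l : L x) => (i : I x) < l) μ := by
  rw [edim_comp (fun x (l : L x) => (l : I x)) μ, homExcess]
  simp only [card_filter_lt_sub_card_filter_lt]
  have h1 : ∀ x, (Fintype.card (I x) : ℤ) - (Fintype.card (L x) : ℤ) =
      (Fintype.card {i // i ∉ L x} : ℤ) := by
    intro x
    have : Fintype.card {j // j ∉ L x} + (L x).card = Fintype.card (I x) := by
      rw [Fintype.card_subtype_compl, Fintype.card_coe]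
      exact Nat.sub_add_cancel (Finset.card_le_univ _)
    rw [← this, Fintype.card_coe]
    push_cast
    ring
  simp only [h1]
  ring

/-- A family of positions which is not intersecting has an intersecting subfamily of negative
expected dimension. -/
theorem exists_isIntersecting_edim_neg {L : ∀ x, Finset (I x)}
    (h : ¬ IsIntersecting src tgt fun x (l : L x) => (l : I x)) :
    ∃ M : ∀ x, Finset (L x), IsIntersecting src tgt (fun x (m : M x) => (m : L x)) ∧
      edim src tgt (fun x (m : M x) => ((m : L x) : I x)) < 0 := by
  have h0 : ∀ p, ¬ Function.Surjective (homCommutator src tgt (J := fun x => L x)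
      (W := fun x => {i // i ∉ L x}) (fun x i l => (i : I x) < l) p) := by
    rintro ⟨u, w⟩ hp
    exact h (isIntersecting_of_surjective L u w hp)
  obtain ⟨H, hH, hH', μ, hμ, hμI, hpos⟩ := exists_isIntersecting_homExcess_pos
    (src := src) (tgt := tgt) (J := fun x => L x) (W := fun x => {i // i ∉ L x})
    (fun x i l => (i : I x) < l) h0
  have hR : ∀ x (w : {i // i ∉ L x}) (i j : L x), i ≤ j → (w : I x) < i → (w : I x) < j :=
    fun x w i j hij hi => lt_of_lt_of_le hi hij
  obtain ⟨M, hM, h1, h2⟩ := exists_finset_isIntersecting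
    (R := fun x (i : {i // i ∉ L x}) (l : L x) => (i : I x) < l) hR hμ hμI hpos
  refine ⟨M, hM, ?_⟩
  rw [edim_comp_val L fun x (m : M x) => (m : L x)]
  linarith

end Core

section Translate

variable {V A : Type} {src tgt : A → V}
variable {J I : V → Type} [∀ x, LinearOrder (J x)] [∀ x, Fintype (J x)]
  [∀ x, LinearOrder (I x)] [∀ x, Fintype (I x)]

theorem isIntersecting_orderIso (e : ∀ x, J x ≃o I x) :
    IsIntersecting src tgt fun x j => e x j := by
  intro r
  have h : Embeds src tgt (fun x (i : I x) => i) r :=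
    ⟨r, fun _ => 1, fun _ => 1, fun _ _ _ h => Matrix.one_apply_ne h.ne',
      fun _ => Matrix.one_mul _, fun _ => by rw [Matrix.mul_one, Matrix.one_mul]⟩
  exact h.of_le (fun x => (e x).toEquiv) fun _ _ => le_rfl

theorem exists_orderIso_finset {J I : Type} [LinearOrder J] [LinearOrder I] {f : J → I}
    (hf : StrictMono f) {N : Finset I} (hN : ∀ i, i ∈ N ↔ ∃ j, f j = i) :
    ∃ e : J ≃o N, ∀ j, (e j : I) = f j := by
  refine ⟨StrictMono.orderIsoOfSurjective (fun j => (⟨f j, (hN _).2 ⟨j, rfl⟩⟩ : N))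
    (fun i j hij => hf hij) ?_, fun j => rfl⟩
  rintro ⟨i, hi⟩
  obtain ⟨j, rfl⟩ := (hN i).1 hi
  exact ⟨j, rfl⟩

theorem isIntersecting_val_iff {f : ∀ x, J x → I x} (hf : ∀ x, StrictMono (f x))
    {N : ∀ x, Finset (I x)} (hN : ∀ x i, i ∈ N x ↔ ∃ j, f x j = i) :
    IsIntersecting src tgt (fun x (i : N x) => (i : I x)) ↔ IsIntersecting src tgt f := by
  choose e he using fun x => exists_orderIso_finset (hf x) (hN x)
  refine ⟨fun h r => (h r).of_le (fun x => (e x).toEquiv) fun x j => (he x j).le,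
    fun h r => (h r).of_le (fun x => (e x).symm.toEquiv) fun x i => ?_⟩
  rw [← he]
  simp

theorem edim_val_eq [Fintype V] [Fintype A] {f : ∀ x, J x → I x} (hf : ∀ x, StrictMono (f x))
    {N : ∀ x, Finset (I x)} (hN : ∀ x i, i ∈ N x ↔ ∃ j, f x j = i) :
    edim src tgt (fun x (i : N x) => (i : I x)) = edim src tgt f := by
  choose e he using fun x => exists_orderIso_finset (hf x) (hN x)
  rw [← edim_congr _ e]
  simp only [he]

theorem stdFlag_succ_eq_coordSubspace {n : ℕ} (i : Fin n) :
    stdFlag n ((i : ℕ) + 1) = coordSubspace (· ≤ i) := by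
  ext v
  refine forall_congr' fun j => ?_
  rw [not_le, Fin.lt_def, Nat.succ_le_iff]

theorem card_filter_le_orderIsoOfFin {n : ℕ} (K : Finset (Fin n)) (j : Fin K.card) :
    (Finset.univ.filter (· ≤ K.orderIsoOfFin rfl j)).card = (j : ℕ) + 1 := by
  rw [← Fin.card_Iic j]
  refine (Finset.card_equiv (K.orderIsoOfFin rfl).toEquiv fun i => ?_).symm
  simp

theorem card_filter_lt_orderIsoOfFin {n : ℕ} (K : Finset (Fin n)) (j : Fin K.card) :
    (Finset.univ.filter (· < K.orderIsoOfFin rfl j)).card = (j : ℕ) := by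
  rw [← Fin.card_Iio j]
  refine (Finset.card_equiv (K.orderIsoOfFin rfl).toEquiv fun i => ?_).symm
  simp

theorem isQIntersecting_iff_isIntersecting {n : V → ℕ} {K : ∀ x, Finset (Fin (n x))} :
    IsQIntersecting src tgt n K ↔ IsIntersecting src tgt fun x (i : K x) => (i : Fin (n x)) := by
  have hm : ∀ x, Monotone fun i : K x => (i : Fin (n x)) := fun _ => Subtype.mono_coe _
  have hS : ∀ S : ∀ x, Submodule ℂ (Fin (n x) → ℂ),
      ((∀ x, ∀ j : Fin (K x).card, (j : ℕ) + 1 ≤ Module.finrank ℂ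
        ((S x ⊓ stdFlag (n x) ((((K x).orderIsoOfFin rfl j : Fin (n x)) : ℕ) + 1) :
            Submodule ℂ (Fin (n x) → ℂ)))) ↔ ∀ x (j : K x), (Finset.univ.filter (· ≤ j)).card ≤
        Module.finrank ℂ (S x ⊓ coordSubspace (· ≤ (j : Fin (n x))) :
          Submodule ℂ (Fin (n x) → ℂ))) := by
    intro S
    refine forall_congr' fun x => ?_
    refine Iff.trans (forall_congr' fun j => ?_) ((K x).orderIsoOfFin rfl).surjective.forall.symm
    rw [card_filter_le_orderIsoOfFin, stdFlag_succ_eq_coordSubspace]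
  constructor
  · intro h r
    rw [embeds_iff_exists_isSubrep hm]
    obtain ⟨S, h1, h2, h3⟩ := h fun a => (r a).mulVecLin
    refine ⟨S, fun a v hv => h3 a ⟨v, hv, rfl⟩, fun x => ?_, (hS S).1 h2⟩
    rw [h1, Fintype.card_coe]
  · intro h r
    obtain ⟨S, h1, h2, h3⟩ := (embeds_iff_exists_isSubrep hm).1
      (h fun a => LinearMap.toMatrix' (r a))
    refine ⟨S, fun x => ?_, (hS S).2 h3, ?_⟩
    · rw [h2, Fintype.card_coe]
    · rintro a _ ⟨v, hv, rfl⟩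
      have := h1 a v hv
      rwa [LinearMap.toMatrix'_mulVec] at this

theorem edimQB_eq_edim [Fintype V] [Fintype A] {n : V → ℕ} {K : ∀ x, Finset (Fin (n x))} :
    edimQB src tgt n K = edim src tgt fun x (i : K x) => (i : Fin (n x)) := by
  simp only [edimQB, edim, Fintype.card_coe, Fintype.card_fin]
  congr 1
  refine Finset.sum_congr rfl fun x _ => ?_
  refine Fintype.sum_equiv ((K x).orderIsoOfFin rfl).toEquiv _ _ fun j => ?_
  have h1 : (Finset.univ.filter (· < ((K x).orderIsoOfFin rfl j : Fin (n x)))).card =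
      (((K x).orderIsoOfFin rfl j : Fin (n x)) : ℕ) := by
    rw [← Fin.card_Iio]
    congr 1
    ext
    simp only [Finset.mem_filter, Finset.mem_univ, true_and, Finset.mem_Iio]
  have h2 := card_filter_lt_orderIsoOfFin (K x) j
  change _ = ((Finset.univ.filter (· < ((K x).orderIsoOfFin rfl j : Fin (n x)))).card : ℤ) -
    ((Finset.univ.filter (· < (K x).orderIsoOfFin rfl j)).card : ℤ)
  rw [h1, h2]

end Translate

/-- inductive criterion for `Q`-intersecting Schubert families.
`K` is `Q`-intersecting for `n` iff `edim_{Q,B}(K,n) ≥ 0` and for every proper family `L`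
that is `Q`-intersecting for the dimension vector `k = (|K_x|)`, the composed family
`K ∘ L` is `Q`-intersecting for `n`. -/
theorem qIntersecting_inductive_criterion
    {V A : Type} [Fintype V] [Fintype A] (src tgt : A → V)
    (hacyc : NoCycles src tgt) (n : V → ℕ) (K : ∀ x : V, Finset (Fin (n x))) :
    IsQIntersecting src tgt n K ↔
      0 ≤ edimQB src tgt n K ∧
      (∀ L : ∀ x : V, Finset (Fin (K x).card),
        L ≠ (fun x => Finset.univ) →
        IsQIntersecting src tgt (fun x => (K x).card) L →
        IsQIntersecting src tgt n (composeFam K L)) := by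
  have hlt : ∀ x, StrictMono fun j => ((K x).orderIsoOfFin rfl j : Fin (n x)) :=
    fun x => (Subtype.strictMono_coe _).comp ((K x).orderIsoOfFin rfl).strictMono
  have hcomp : ∀ (L : ∀ x, Finset (Fin (K x).card)) x i,
      i ∈ composeFam K L x ↔ ∃ l : L x, ((K x).orderIsoOfFin rfl l : Fin (n x)) = i := by
    intro L x i
    simp [composeFam]
  have hltL : ∀ (L : ∀ x, Finset (Fin (K x).card)) x,
      StrictMono fun l : L x => ((K x).orderIsoOfFin rfl l : Fin (n x)) :=
    fun L x => (hlt x).comp (Subtype.strictMono_coe _)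
  simp only [isQIntersecting_iff_isIntersecting, edimQB_eq_edim]
  constructor
  · intro hK
    refine ⟨hK.edim_nonneg fun _ => Subtype.mono_coe _, fun L _ hL => ?_⟩
    rw [isIntersecting_val_iff (hltL L) (hcomp L)]
    refine IsIntersecting.comp (κ := fun x j => ((K x).orderIsoOfFin rfl j : Fin (n x)))
      ?_ hL fun x => (hlt x).monotone
    exact hK.comp (isIntersecting_orderIso fun x => (K x).orderIsoOfFin rfl)
      fun _ => Subtype.mono_coe _
  · rintro ⟨h0, hL⟩
    by_contra hK
    obtain ⟨M, hM, hneg⟩ := exists_isIntersecting_edim_neg hK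
    have hltM : ∀ x, StrictMono fun m : M x => ((m : K x) : Fin (n x)) := fun x =>
      (Subtype.strictMono_coe _).comp (Subtype.strictMono_coe _)
    let L : ∀ x, Finset (Fin (K x).card) :=
      fun x => Finset.univ.filter fun j => (K x).orderIsoOfFin rfl j ∈ M x
    have hLM : ∀ x j, j ∈ L x ↔ ∃ m : M x, ((K x).orderIsoOfFin rfl).symm m = j := by
      intro x j
      simp only [L, Finset.mem_filter, Finset.mem_univ, true_and, OrderIso.symm_apply_eq]
      exact ⟨fun h => ⟨⟨_, h⟩, rfl⟩, fun ⟨m, hm⟩ => hm ▸ m.2⟩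
    by_cases hu : L = fun x => Finset.univ
    · rw [← edim_val_eq (N := K) hltM] at hneg
      · exact hneg.not_ge h0
      · intro x i
        refine ⟨fun hi => ?_, fun ⟨m, hm⟩ => hm ▸ m.1.2⟩
        have h1 : ((K x).orderIsoOfFin rfl).symm ⟨i, hi⟩ ∈ L x := by
          rw [hu]
          exact Finset.mem_univ _
        simp only [L, Finset.mem_filter, OrderIso.apply_symm_apply] at h1
        exact ⟨⟨_, h1.2⟩, rfl⟩
    · have h1 := hL L hu <| (isIntersecting_val_iff
        (fun x => ((K x).orderIsoOfFin rfl).symm.strictMono.comp (Subtype.strictMono_coe _))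
          hLM).2 <| (isIntersecting_orderIso fun x => ((K x).orderIsoOfFin rfl).symm).comp hM
        fun x => OrderIso.monotone _
      have h2 := h1.edim_nonneg fun _ => Subtype.mono_coe _
      rw [edim_val_eq (N := composeFam K L) hltM] at h2
      · exact hneg.not_ge h2
      · intro x i
        rw [hcomp]
        constructor
        · rintro ⟨⟨l, hl⟩, rfl⟩
          obtain ⟨m, rfl⟩ := (hLM x l).1 hl
          exact ⟨m, by simp⟩
        · rintro ⟨m, rfl⟩
          exact ⟨⟨_, (hLM x _).2 ⟨m, rfl⟩⟩, by simp⟩
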